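/- arXiv:1103.0712 — 3 statements merged into one kernel-verified Lean document; each statement's English description precedes it below -/
import Mathlib

section
/- Let u₀ < u₁ be real numbers, 𝒩 = (u₀,u₁], and ρ̄(u) = (u−u₀)/2. For every C^∞ function ψ : ℝ → ℝ whose support is a compact subset of 𝒩, one has sup_{u∈𝒩} ρ̄(u)^{−3/2}|ψ(u)| ≤ √(2/3) · ( ∫_{u₀}^{u₁} ( ρ̄(u)^{−2} ψ′(u)² + ρ̄(u)^{−4} ψ(u)² ) du )^{1/2}. -/
open Real Set Filter MeasureTheory Topology

noncomputable section

lemma continuous_mul_of_notMem_tsupport {w g : ℝ → ℝ} {a : ℝ}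
    (hw : ContinuousOn w {a}ᶜ) (hg : Continuous g) (ha : a ∉ tsupport g) :
    Continuous fun x ↦ w x * g x := by
  refine continuous_of_tsupport fun x hx ↦ ?_
  have hxa : x ≠ a := by
    rintro rfl
    exact ha (tsupport_mul_subset_right hx)
  exact (hw.continuousAt (isOpen_compl_singleton.mem_nhds hxa)).mul hg.continuousAt

/-- The pointwise inequality behind the weighted Sobolev estimate: the derivative of
`ρ⁻³ ψ²` is bounded by `2/3` of the energy density. -/
lemma deriv_density_le {s p d : ℝ} (hs : 0 < s) :
    -(3 / 2) * (s ^ 4)⁻¹ * p ^ 2 + (s ^ 3)⁻¹ * (2 * p * d) ≤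
      2 / 3 * ((s ^ 2)⁻¹ * d ^ 2 + (s ^ 4)⁻¹ * p ^ 2) := by
  have h : 2 / 3 * ((s ^ 2)⁻¹ * d ^ 2 + (s ^ 4)⁻¹ * p ^ 2) -
      (-(3 / 2) * (s ^ 4)⁻¹ * p ^ 2 + (s ^ 3)⁻¹ * (2 * p * d)) =
      2 / 3 * (s⁻¹ * d - 3 / 2 * (s⁻¹ ^ 2 * p)) ^ 2 + 2 / 3 * (s⁻¹ ^ 2 * p) ^ 2 := by
    field_simp
    ring
  have : 0 ≤ 2 / 3 * (s⁻¹ * d - 3 / 2 * (s⁻¹ ^ 2 * p)) ^ 2 + 2 / 3 * (s⁻¹ ^ 2 * p) ^ 2 := by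
    positivity
  linarith

lemma notMem_tsupport_sq {g : ℝ → ℝ} {a : ℝ} (ha : a ∉ tsupport g) :
    a ∉ tsupport fun x ↦ g x ^ 2 := by
  rw [notMem_tsupport_iff_eventuallyEq] at ha ⊢
  filter_upwards [ha] with x hx
  simp [hx]

lemma continuousOn_inv_pow_half_sub (a : ℝ) (n : ℕ) :
    ContinuousOn (fun x ↦ (((x - a) / 2) ^ n)⁻¹) {a}ᶜ := by
  refine ContinuousOn.inv₀ (by fun_prop) fun x hx ↦ ?_
  have := sub_ne_zero.mpr hx
  positivity

lemma weighted_sq_le_integral {u₀ u : ℝ} (hu : u₀ < u) {ψ : ℝ → ℝ} (hψ : ContDiff ℝ 1 ψ)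
    (h₀ : u₀ ∉ tsupport ψ) {e : ℝ → ℝ} (he : Continuous e)
    (hee : ∀ x, e x = (((x - u₀) / 2) ^ 2)⁻¹ * deriv ψ x ^ 2 +
      (((x - u₀) / 2) ^ 4)⁻¹ * ψ x ^ 2) :
    (((u - u₀) / 2) ^ 3)⁻¹ * ψ u ^ 2 ≤ 2 / 3 * ∫ x in Ioc u₀ u, e x := by
  have hF : Continuous fun x ↦ (((x - u₀) / 2) ^ 3)⁻¹ * ψ x ^ 2 :=
    continuous_mul_of_notMem_tsupport (continuousOn_inv_pow_half_sub u₀ 3)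
      (hψ.continuous.pow 2) (notMem_tsupport_sq h₀)
  have key := intervalIntegral.sub_le_integral_of_hasDeriv_right_of_le hu.le hF.continuousOn
    (g' := fun x ↦ -(3 / 2) * (((x - u₀) / 2) ^ 4)⁻¹ * ψ x ^ 2 +
      (((x - u₀) / 2) ^ 3)⁻¹ * (2 * ψ x * deriv ψ x)) (φ := fun x ↦ 2 / 3 * e x) ?_
    (he.const_mul _).continuousOn.integrableOn_Icc ?_
  · rw [intervalIntegral.integral_of_le hu.le, integral_const_mul] at key
    simpa [image_eq_zero_of_notMem_tsupport h₀] using key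
  · intro x hx
    have hxu : x - u₀ ≠ 0 := sub_ne_zero.mpr hx.1.ne'
    have hd := (hψ.differentiable one_ne_zero x).hasDerivAt
    have hw := ((((hasDerivAt_id x).sub_const u₀).div_const 2).pow 3).inv
      (pow_ne_zero 3 (div_ne_zero hxu two_ne_zero))
    refine ((hw.mul (hd.pow 2)).congr_deriv ?_).hasDerivWithinAt
    simp only [id, Pi.pow_apply, Pi.inv_apply]
    field_simp
    ring
  · intro x hx
    simp only [hee]
    exact deriv_density_le (by linarith [hx.1])

/-- **Weighted Sobolev inequality for the AdS-type `H¹` norm.**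
On `𝒩 = (u₀, u₁]` with weight `ρ̄(u) = (u - u₀)/2`, every smooth function `ψ` whose support
is a compact subset of `𝒩` satisfies
`ρ̄(u)^{-3/2} |ψ(u)| ≤ √(2/3) · ‖ψ‖_{H¹_AdS(𝒩)}` for every `u ∈ 𝒩`. -/
theorem stmt_0 (u₀ u₁ : ℝ) (hu : u₀ < u₁) (ψ : ℝ → ℝ)
    (hsmooth : ContDiff ℝ (⊤ : ℕ∞) ψ)
    (hcompact : IsCompact (tsupport ψ))
    (hsupp : tsupport ψ ⊆ Set.Ioc u₀ u₁) :
    ∀ u ∈ Set.Ioc u₀ u₁,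
      ((u - u₀) / 2) ^ (-(3 : ℝ) / 2) * |ψ u| ≤
        Real.sqrt (2 / 3) *
          (∫ x in Set.Ioc u₀ u₁,
              (((x - u₀) / 2) ^ (-(2 : ℝ)) * (deriv ψ x) ^ 2 +
                ((x - u₀) / 2) ^ (-(4 : ℝ)) * (ψ x) ^ 2)) ^ ((1 : ℝ) / 2) := by
  intro u hu'
  have h₀ : u₀ ∉ tsupport ψ := fun h ↦ lt_irrefl _ (hsupp h).1
  have hψ : ContDiff ℝ 1 ψ := hsmooth.of_le (by exact_mod_cast le_top)
  have hrpow : ∀ (y : ℝ) (n : ℕ), y ^ (-(n : ℝ)) = (y ^ n)⁻¹ := fun y n ↦ by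
    rw [← zpow_natCast, ← zpow_neg, ← rpow_intCast]
    simp
  set e : ℝ → ℝ := fun x ↦ ((x - u₀) / 2) ^ (-(2 : ℝ)) * (deriv ψ x) ^ 2 +
    ((x - u₀) / 2) ^ (-(4 : ℝ)) * (ψ x) ^ 2 with he
  have hee : ∀ x, e x = (((x - u₀) / 2) ^ 2)⁻¹ * deriv ψ x ^ 2 +
      (((x - u₀) / 2) ^ 4)⁻¹ * ψ x ^ 2 := fun x ↦ by
    have h2 := hrpow ((x - u₀) / 2) 2
    have h4 := hrpow ((x - u₀) / 2) 4
    push_cast at h2 h4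
    simp only [he, h2, h4]
  have hcont : Continuous e := by
    rw [funext hee]
    exact (continuous_mul_of_notMem_tsupport (continuousOn_inv_pow_half_sub u₀ 2)
      ((hψ.continuous_deriv le_rfl).pow 2)
      (notMem_tsupport_sq fun h ↦ h₀ (tsupport_deriv_subset h))).add
      (continuous_mul_of_notMem_tsupport (continuousOn_inv_pow_half_sub u₀ 4)
        (hψ.continuous.pow 2) (notMem_tsupport_sq h₀))
  have he0 : ∀ x, 0 ≤ e x := fun x ↦ by
    rw [hee]
    positivity
  have hmono : ∫ x in Ioc u₀ u, e x ≤ ∫ x in Ioc u₀ u₁, e x :=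
    setIntegral_mono_set hcont.integrableOn_Ioc (Eventually.of_forall he0)
      (Ioc_subset_Ioc_right hu'.2).eventuallyLE
  have hmain := weighted_sq_le_integral hu'.1 hψ h₀ hcont hee
  have hs : 0 < (u - u₀) / 2 := by linarith [hu'.1]
  rw [← Real.sqrt_eq_rpow, ← Real.sqrt_mul (by norm_num)]
  refine Real.le_sqrt_of_sq_le ?_
  have hsq : (((u - u₀) / 2) ^ (-(3 : ℝ) / 2)) ^ 2 = (((u - u₀) / 2) ^ 3)⁻¹ := by
    have h3 := hrpow ((u - u₀) / 2) 3
    push_cast at h3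
    rw [← h3, ← rpow_mul_natCast hs.le]
    norm_num
  rw [mul_pow, sq_abs, hsq]
  linarith
end
end

section
/- Fix a > −9/8, l > 0, M > 0 and set s = min(√(9+8a),1). Let b, c, D > 0, and let r̃, ϖ be C² resp. C¹ functions on Δ_{δ,u₀} satisfying: 1/2 ≤ r̃/ρ ≤ 2, |r̃_u − 1/2| ≤ 1/4, |r̃_v + 1/2| ≤ 1/4, |r̃_{uv}| ≤ b ρ², |ϖ − M| ≤ b ρ^{s/4}, and let r > 0 be determined by r_u = −r̃_u(1−μ_M), r_v = −r̃_v(1−μ_M), r → ∞ at the diagonal, with c⁻¹ ρ⁻¹ ≤ r ≤ c ρ⁻¹; assume moreover (1−μ)/r² ≥ 1/(2l²), (1−μ_M)/r² ≥ 1/(2l²), and the near-boundary coordinate normalization |κ − 1/2| ≤ b ρ³ and |γ − 1/2| ≤ b ρ³, where κ = r_v/(1−μ) and γ = −r_u/(1−μ). Let ψ be a C² solution on Δ_{δ,u₀} of ψ_{uv} + (r_u/r)ψ_v + (r_v/r)ψ_u + (Ω²_{aux} a/(2l²))ψ = 0, where Ω²_{aux} = −4 r̃_u r̃_v (1−μ_M)²/(1−μ),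 and suppose for some N > 0 and all (u,v) ∈ Δ_{δ,u₀}: ∫_v^u [ (∂_u Tψ)² + (∂_u ψ)² + ψ²(1−μ) + (Tψ)²(1−μ) ] r² (u′,v) du′ ≤ D N², ∫_{u₀}^v [ (∂_v Tψ)² + (∂_v ψ)² + ψ²(1−μ) + (Tψ)²(1−μ) ] r² (u,v′) dv′ ≤ D N², and sup_{v=u₀} |r^{5/2+s} ψ_u/r_u| ≤ N. Then there exist δ₀ > 0 and C > 0, depending only on a, l, M, b, c, D, such that if δ ≤ δ₀ then |ψ| ≤ C N r^{−3/2−s/2} and |ψ_u| + |ψ_v| ≤ C N r^{−1/2−s/2} everywhere on Δ_{δ,u₀}. -/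
open Real Set Filter MeasureTheory Topology

noncomputable section

/-- `s = min(√(9+8a), 1)`. -/
def sconst (a : ℝ) : ℝ := min (Real.sqrt (9 + 8 * a)) 1

/-- The triangular domain `Δ_{δ,u₀} = {(u,v) : v ≥ u₀, u₀+δ ≥ u > v}`
(first coordinate `u`, second coordinate `v`). -/
def Tri (u₀ δ : ℝ) : Set (ℝ × ℝ) := {p : ℝ × ℝ | u₀ ≤ p.2 ∧ p.2 < p.1 ∧ p.1 ≤ u₀ + δ}

/-- The weight `ρ(u,v) = (u-v)/2`. -/
def rho (p : ℝ × ℝ) : ℝ := (p.1 - p.2) / 2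

/-- Partial derivative in the first (outgoing, `u`) null coordinate. -/
def pdu (f : ℝ × ℝ → ℝ) (p : ℝ × ℝ) : ℝ := deriv (fun x => f (x, p.2)) p.1

/-- Partial derivative in the second (ingoing, `v`) null coordinate. -/
def pdv (f : ℝ × ℝ → ℝ) (p : ℝ × ℝ) : ℝ := deriv (fun y => f (p.1, y)) p.2

/-- The vector field `T = ∂_u + ∂_v`. -/
def Td (f : ℝ × ℝ → ℝ) (p : ℝ × ℝ) : ℝ := pdu f p + pdv f p

/-- `1 - μ = 1 - 2ϖ/r + r²/l²`. -/
def oneMinusMu (l : ℝ) (r ϖ : ℝ × ℝ → ℝ) (p : ℝ × ℝ) : ℝ :=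
  1 - 2 * ϖ p / r p + (r p) ^ 2 / l ^ 2

/-- `1 - μ_M = 1 - 2M/r + r²/l²`. -/
def oneMinusMuM (M l : ℝ) (r : ℝ × ℝ → ℝ) (p : ℝ × ℝ) : ℝ :=
  1 - 2 * M / r p + (r p) ^ 2 / l ^ 2

/-- The auxiliary conformal factor `Ω²_aux = -4 r̃_u r̃_v (1-μ_M)²/(1-μ)`. -/
def OmAuxSq (M l : ℝ) (tr r ϖ : ℝ × ℝ → ℝ) (p : ℝ × ℝ) : ℝ :=
  -4 * pdu tr p * pdv tr p * (oneMinusMuM M l r p) ^ 2 / oneMinusMu l r ϖ p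

theorem abs_le_of_abs_deriv_le_rpow {g g' : ℝ → ℝ} {R q A : ℝ} (hq : 0 < q)
    (hg : ∀ x ∈ Ioo 0 R, HasDerivAt g (g' x) x)
    (hg' : ∀ x ∈ Ioo 0 R, |g' x| ≤ A * x ^ (q - 1))
    (h0 : Tendsto g (𝓝[>] 0) (𝓝 0)) {x : ℝ} (hx : x ∈ Ioo 0 R) :
    |g x| ≤ A / q * x ^ q := by
  have hpow : ∀ y ∈ Ioo 0 R, HasDerivAt (fun y : ℝ => A / q * y ^ q) (A * y ^ (q - 1)) y := by
    intro y hy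
    have := (Real.hasDerivAt_rpow_const (x := y) (p := q) (Or.inl hy.1.ne')).const_mul (A / q)
    refine this.congr_deriv ?_
    field_simp
  have hpow0 : Tendsto (fun y : ℝ => A / q * y ^ q) (𝓝[>] 0) (𝓝 0) := by
    have h : Continuous (fun y : ℝ => A / q * y ^ q) :=
      continuous_const.mul (Real.continuous_rpow_const hq.le)
    have := (h.tendsto 0).mono_left (nhdsWithin_le_nhds (s := Ioi (0:ℝ)))
    simpa [Real.zero_rpow hq.ne'] using this
  have key : ∀ f f' : ℝ → ℝ, (∀ y ∈ Ioo 0 R, HasDerivAt f (f' y) y) →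
      (∀ y ∈ Ioo 0 R, 0 ≤ f' y) → Tendsto f (𝓝[>] 0) (𝓝 0) → 0 ≤ f x := by
    intro f f' hf hf' hf0
    have hmono : MonotoneOn f (Ioo 0 R) := by
      apply monotoneOn_of_deriv_nonneg (convex_Ioo 0 R)
      · exact fun y hy => (hf y hy).continuousAt.continuousWithinAt
      · rw [interior_Ioo]
        exact fun y hy => (hf y hy).differentiableAt.differentiableWithinAt
      · rw [interior_Ioo]
        intro y hy
        rw [(hf y hy).deriv]
        exact hf' y hy
    refine le_of_tendsto hf0 ?_
    filter_upwards [Ioo_mem_nhdsGT hx.1] with y hy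
    exact hmono ⟨hy.1, hy.2.trans hx.2⟩ hx hy.2.le
  rw [abs_le]
  constructor
  · have := key (fun y => A / q * y ^ q + g y) (fun y => A * y ^ (q - 1) + g' y)
      (fun y hy => (hpow y hy).add (hg y hy))
      (fun y hy => by have := (abs_le.1 (hg' y hy)).1; linarith)
      (by simpa using hpow0.add h0)
    linarith
  · have := key (fun y => A / q * y ^ q - g y) (fun y => A * y ^ (q - 1) - g' y)
      (fun y hy => (hpow y hy).sub (hg y hy))
      (fun y hy => by have := (abs_le.1 (hg' y hy)).2; linarith)
      (by simpa using hpow0.sub h0)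
    linarith

theorem le_rpow_of_singular_ode {Y Y' : ℝ → ℝ} {α γ E K N R : ℝ} (hγα : γ ≤ α)
    (hγ2 : γ ≤ 2) (hE : 0 ≤ E) (hK : 0 < K) (hN : 0 < N) (hR4 : R ≤ 1 / 4)
    (hER : E * R ≤ 1 / 8) (hYc : ContinuousOn Y (Ioc 0 R))
    (hY : ∀ x ∈ Ioo 0 R, HasDerivAt Y (Y' x) x)
    (hode : ∀ x ∈ Ioo 0 R,
      α * Y x - E * x ^ 2 * |Y x| - K * N * x ^ ((5 : ℝ) / 2) ≤ x * Y' x)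
    (hYR : Y R ≤ K * N * R ^ γ) {x : ℝ} (hx : x ∈ Ioo 0 R) :
    Y x ≤ 4 * K * N * x ^ γ := by
  set B : ℝ → ℝ := fun y => 4 * K * N * (y ^ γ - y ^ (γ + 1 / 2)) with hB
  set B' : ℝ → ℝ := fun y =>
    4 * K * N * (γ * y ^ (γ - 1) - (γ + 1 / 2) * y ^ (γ + 1 / 2 - 1)) with hB'
  have hR : 0 < R := hx.1.trans hx.2
  have hBd : ∀ y, 0 < y → HasDerivAt B (B' y) y := fun y hy =>
    ((Real.hasDerivAt_rpow_const (Or.inl hy.ne')).sub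
      (Real.hasDerivAt_rpow_const (Or.inl hy.ne'))).const_mul _
  have hsqrt : ∀ y : ℝ, 0 < y → y ≤ 1 / 4 → y ^ (1 / 2 : ℝ) ≤ 1 / 2 := by
    intro y hy hy4
    rw [← Real.sqrt_eq_rpow, Real.sqrt_le_left (by norm_num)]
    linarith
  have hstrict : Y R < B R := by
    refine hYR.trans_lt ?_
    have h1 : R ^ (γ + 1 / 2) = R ^ γ * R ^ (1 / 2 : ℝ) := Real.rpow_add hR _ _
    have h2 := hsqrt R hR hR4
    have h3 : 0 < K * N * R ^ γ := by positivity
    simp only [hB, h1]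
    nlinarith
  have hev : ∀ᶠ y in 𝓝[<] R, Y y < B y := by
    have c1 : Tendsto Y (𝓝[<] R) (𝓝 (Y R)) := by
      refine (hYc R ⟨hR, le_rfl⟩).mono_left ?_
      rw [← nhdsWithin_Ioo_eq_nhdsLT hR]
      exact nhdsWithin_mono _ Ioo_subset_Ioc_self
    have c2 : Tendsto B (𝓝[<] R) (𝓝 (B R)) :=
      (hBd R hR).continuousAt.tendsto.mono_left nhdsWithin_le_nhds
    exact c1.eventually_lt c2 hstrict
  obtain ⟨R', hR'B, hxR', hR'R⟩ := (hev.and (Ioo_mem_nhdsLT hx.2)).exists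
  have hle : Y x ≤ B x := by
    have hder : ∀ z ∈ Icc (-R') (-x), HasDerivAt (fun z => Y (-z)) (-(Y' (-z))) z := by
      intro z hz
      have := (hY (-z) ⟨by linarith [hz.2, hx.1], by linarith [hz.1]⟩).comp z (hasDerivAt_neg z)
      exact this.congr_deriv (by simp)
    have hderB : ∀ z ∈ Icc (-R') (-x), HasDerivAt (fun z => B (-z)) (-(B' (-z))) z := by
      intro z hz
      have := (hBd (-z) (by linarith [hz.2, hx.1])).comp z (hasDerivAt_neg z)
      exact this.congr_deriv (by simp)
    have := image_le_of_deriv_right_lt_deriv_boundary'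
      (f := fun z => Y (-z)) (f' := fun z => -(Y' (-z))) (a := -R') (b := -x)
      (B := fun z => B (-z)) (B' := fun z => -(B' (-z)))
      (fun z hz => (hder z hz).continuousAt.continuousWithinAt)
      (fun z hz => (hder z ⟨hz.1, hz.2.le⟩).hasDerivWithinAt)
      (by simpa using hR'B.le)
      (fun z hz => (hderB z hz).continuousAt.continuousWithinAt)
      (fun z hz => (hderB z ⟨hz.1, hz.2.le⟩).hasDerivWithinAt)
      (by
        intro z hz heq
        set y := -z with hy
        have hy0 : 0 < y := by linarith [hz.2, hx.1]
        have hyR : y < R := by linarith [hz.1]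
        have ho := hode y ⟨hy0, hyR⟩
        have hp : y ^ (γ + 1 / 2) = y ^ γ * y ^ (1 / 2 : ℝ) := Real.rpow_add hy0 _ _
        have hp1 : y * y ^ (γ - 1) = y ^ γ := by
          rw [mul_comm, ← Real.rpow_add_one hy0.ne']; ring_nf
        have hp2 : y * y ^ (γ + 1 / 2 - 1) = y ^ γ * y ^ (1 / 2 : ℝ) := by
          rw [← hp, mul_comm, ← Real.rpow_add_one hy0.ne']; ring_nf
        have hp3 : y ^ ((5 : ℝ) / 2) ≤ y ^ γ * y ^ (1 / 2 : ℝ) := by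
          rw [← hp]
          exact Real.rpow_le_rpow_of_exponent_ge hy0 (by linarith) (by linarith)
        have hs := hsqrt y hy0 (by linarith)
        have hs0 : 0 < y ^ (1 / 2 : ℝ) := by positivity
        have hss : y ≤ y ^ (1 / 2 : ℝ) := by
          conv_lhs => rw [← Real.rpow_one y]
          exact Real.rpow_le_rpow_of_exponent_ge hy0 (by linarith) (by norm_num)
        set t := y ^ (1 / 2 : ℝ)
        set G := y ^ γ with hG
        have hG0 : 0 < G := by positivity
        have hBy : B y = 4 * K * N * (G - G * t) := by simp only [hB, hp, ← hG]
        have hBy0 : 0 ≤ B y := by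
          rw [hBy]
          have : 0 ≤ G - G * t := by nlinarith
          positivity
        have hyB' : y * B' y = 4 * K * N * (γ * G - (γ + 1 / 2) * (G * t)) := by
          simp only [hB']
          linear_combination 4 * K * N * γ * hp1 - 4 * K * N * (γ + 1 / 2) * hp2
        have heq' : Y y = B y := heq
        rw [heq', abs_of_nonneg hBy0] at ho
        have h1 : γ * B y ≤ α * B y := mul_le_mul_of_nonneg_right hγα hBy0
        have h2 : E * y ^ 2 * B y ≤ 1 / 8 * (4 * K * N * (G * t)) := by
          have e1 : E * y ≤ 1 / 8 := (mul_le_mul_of_nonneg_left hyR.le hE).trans hER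
          have e2 : y * B y ≤ 4 * K * N * (G * t) := by
            have : B y ≤ 4 * K * N * G := by
              rw [hBy]
              have : 0 ≤ 4 * K * N * (G * t) := by positivity
              linarith
            calc y * B y ≤ t * (4 * K * N * G) := by gcongr
              _ = _ := by ring
          calc E * y ^ 2 * B y = (E * y) * (y * B y) := by ring
            _ ≤ _ := by gcongr
        have h3 : K * N * y ^ ((5 : ℝ) / 2) ≤ K * N * (G * t) := by gcongr
        have h4 : 0 < K * N * (G * t) := by positivity
        have h5 : y * B' y < y * Y' y := by
          rw [hyB']
          have : γ * B y = 4 * K * N * (γ * G - (γ + 1 / 2) * (G * t))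
            + 2 * (K * N * (G * t)) := by rw [hBy]; ring
          linarith
        have := lt_of_mul_lt_mul_left h5 hy0.le
        linarith)
    simpa using this (x := -x) ⟨by linarith, le_rfl⟩
  refine hle.trans ?_
  have : 0 < x ^ (γ + 1 / 2) := Real.rpow_pos_of_pos hx.1 _
  have : 0 < 4 * K * N * x ^ (γ + 1 / 2) := by positivity
  simp only [hB]
  linarith

theorem mul_sq_le_integral_sq_add_sq {f f' : ℝ → ℝ} {v h : ℝ} (hh : 0 < h)
    (hf' : ContinuousOn f' (Icc v (v + h)))
    (hf : ∀ y ∈ Icc v (v + h), HasDerivAt f (f' y) y) :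
    h * f v ^ 2 ≤ ∫ y in v..(v + h), (2 * f y ^ 2 + h ^ 2 * f' y ^ 2) := by
  have hfc : ContinuousOn f (Icc v (v + h)) :=
    fun y hy => (hf y hy).continuousAt.continuousWithinAt
  have huIcc : uIcc v (v + h) = Icc v (v + h) := uIcc_of_le (by linarith)
  have hint : IntervalIntegrable
      (fun y => f y ^ 2 - 2 * (v + h - y) * f y * f' y) volume v (v + h) := by
    apply ContinuousOn.intervalIntegrable
    rw [huIcc]
    fun_prop
  have hint2 : IntervalIntegrable (fun y => 2 * f y ^ 2 + h ^ 2 * f' y ^ 2) volume v (v + h) := by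
    apply ContinuousOn.intervalIntegrable
    rw [huIcc]
    fun_prop
  have hftc : ∫ y in v..(v + h), (f y ^ 2 - 2 * (v + h - y) * f y * f' y) = h * f v ^ 2 := by
    rw [intervalIntegral.integral_eq_sub_of_hasDerivAt
      (f := fun y => -(v + h - y) * f y ^ 2) _ hint]
    · ring
    · intro y hy
      rw [huIcc] at hy
      have h1 : HasDerivAt (fun y : ℝ => -(v + h - y)) 1 y := by
        exact (((hasDerivAt_id y).const_sub (v + h)).neg).congr_deriv (by simp)
      refine (h1.mul ((hf y hy).pow 2)).congr_deriv ?_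
      simp; ring
  rw [← hftc]
  apply intervalIntegral.integral_mono_on (by linarith) hint hint2
  intro y hy
  have h0 : 0 ≤ v + h - y := by linarith [hy.2]
  have h1 : (v + h - y) ^ 2 ≤ h ^ 2 := by
    have : v + h - y ≤ h := by linarith [hy.1]
    gcongr
  nlinarith [sq_nonneg (f y + (v + h - y) * f' y), mul_le_mul_of_nonneg_right h1 (sq_nonneg (f' y))]

/-- Decay towards `x = 0` of solutions of the perturbed Euler system
`P' = 2Q - 2T`, `Q' = (2/x) Q + (a/x²) P + …` with indicial roots `(3 ± √(9+8a))/2`. -/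
theorem exists_decay_of_singular_system (a E K₀ K₁ : ℝ) (ha : -(9 / 8) < a) (hE : 0 < E)
    (hK₀ : 0 < K₀) (hK₁ : 0 < K₁) :
    ∃ δ₀ > 0, ∃ K > 0, ∀ R N : ℝ, 0 < R → R ≤ δ₀ → 0 < N →
      ∀ P Q T A₁ A₂ A₃ : ℝ → ℝ, ContinuousOn P (Ioc 0 R) → ContinuousOn Q (Ioc 0 R) →
      (∀ x ∈ Ioo 0 R, HasDerivAt P (2 * Q x - 2 * T x) x) →
      (∀ x ∈ Ioo 0 R, HasDerivAt Q (A₁ x * Q x + A₂ x * T x + A₃ x * P x) x) →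
      (∀ x ∈ Ioo 0 R, |x * A₁ x - 2| ≤ E * x ^ 2) →
      (∀ x ∈ Ioo 0 R, |x * A₂ x| ≤ E) →
      (∀ x ∈ Ioo 0 R, |x ^ 2 * A₃ x - a| ≤ E * x ^ 2) →
      (∀ x ∈ Ioo 0 R, |P x| ≤ K₀ * N * x ^ ((3 : ℝ) / 2)) →
      (∀ x ∈ Ioo 0 R, |T x| ≤ K₀ * N * x ^ ((3 : ℝ) / 2)) →
      |P R| ≤ K₁ * N * R ^ (3 / 2 + sconst a) →
      |Q R| ≤ K₁ * N * R ^ (1 / 2 + sconst a) →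
      ∀ x ∈ Ioo 0 R, |P x| ≤ K * N * x ^ (3 / 2 + sconst a / 2) ∧
        |Q x| ≤ K * N * x ^ (1 / 2 + sconst a / 2) := by
  set d := √(9 + 8 * a) with hd
  have hd0 : 0 < d := Real.sqrt_pos.2 (by linarith)
  have hd2 : d ^ 2 = 9 + 8 * a := Real.sq_sqrt (by linarith)
  set s := sconst a with hs
  have hsd : s ≤ d := min_le_left _ _
  have hs1 : s ≤ 1 := min_le_right _ _
  have hs0 : 0 < s := lt_min hd0 one_pos
  set α := (3 + d) / 2 with hα
  set β := (3 - d) / 2 with hβ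
  set γ := 3 / 2 + s / 2 with hγ
  set q := γ - β with hq
  have hq0 : 0 < q := by simp only [hq, hγ, hβ]; linarith
  set K₂ := K₁ * (1 + |β| / 2) + E * (|β| / 2) * K₀ + (E + |β|) * K₀ + E * K₀ with hK₂
  have hK₂0 : 0 < K₂ := by positivity
  set K₃ := 2 * (4 * K₂ + K₀) / q with hK₃
  have hK₃0 : 0 < K₃ := by positivity
  refine ⟨min (1 / 4) (1 / (8 * E)), by positivity, K₃ + (4 * K₂ + |β| / 2 * K₃),
    by positivity, ?_⟩
  intro R N hR hRδ hN P Q T A₁ A₂ A₃ hPc hQc hP hQ hA₁ hA₂ hA₃ hPb hTb hPR hQR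
  have hR4 : R ≤ 1 / 4 := hRδ.trans (min_le_left _ _)
  have hER : E * R ≤ 1 / 8 := by
    have : R ≤ 1 / (8 * E) := hRδ.trans (min_le_right _ _)
    calc E * R ≤ E * (1 / (8 * E)) := by gcongr
      _ = 1 / 8 := by field_simp
  set Y : ℝ → ℝ := fun x => x * Q x - β / 2 * P x with hY
  set Y' : ℝ → ℝ := fun x => 1 * Q x + x * (A₁ x * Q x + A₂ x * T x + A₃ x * P x)
    - β / 2 * (2 * Q x - 2 * T x) with hY'
  have hYd : ∀ x ∈ Ioo 0 R, HasDerivAt Y (Y' x) x := fun x hx =>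
    ((hasDerivAt_id x).mul (hQ x hx)).sub ((hP x hx).const_mul _)
  have hYc : ContinuousOn Y (Ioc 0 R) := by fun_prop
  have herr : ∀ x ∈ Ioo 0 R, |x * Y' x - α * Y x| ≤
      E * x ^ 2 * |Y x| + K₂ * N * x ^ ((5 : ℝ) / 2) := by
    intro x hx
    have hx0 := hx.1
    have hx1 : x ≤ 1 := by linarith [hx.2]
    have hab : α * β = -2 * a := by
      simp only [hα, hβ]; linear_combination (-1 / 4) * hd2
    have hαβ : α + β = 3 := by simp only [hα, hβ]; ring
    have hid : x * Y' x - α * Y x = (x * A₁ x - 2) * (x * Q x) + x * ((x * A₂ x + β) * T x)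
        + (x ^ 2 * A₃ x - a) * P x := by
      have h1 : α = 3 - β := by linarith
      simp only [hY', hY]
      linear_combination (β * P x / 2 - x * Q x) * h1
        + (1 / 2) * P x * (hab - β * h1)
    have hxQ : |x * Q x| ≤ |Y x| + |β| / 2 * |P x| := by
      have : x * Q x = Y x + β / 2 * P x := by simp only [hY]; ring
      rw [this]
      refine (abs_add_le _ _).trans ?_
      rw [abs_mul, abs_div, abs_two]
    have hpow : x * x ^ ((3 : ℝ) / 2) = x ^ ((5 : ℝ) / 2) := by
      rw [mul_comm, ← Real.rpow_add_one hx0.ne']; norm_num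
    have hPx := hPb x hx
    have hTx := hTb x hx
    set m := x ^ ((3 : ℝ) / 2) with hm
    have hm0 : 0 < m := by positivity
    have t1 : |(x * A₁ x - 2) * (x * Q x)| ≤
        E * x ^ 2 * |Y x| + E * (|β| / 2) * K₀ * N * (x * m) := by
      rw [abs_mul]
      calc _ ≤ E * x ^ 2 * (|Y x| + |β| / 2 * (K₀ * N * m)) := by
            gcongr
            · exact hA₁ x hx
            · exact hxQ.trans (by gcongr)
        _ = E * x ^ 2 * |Y x| + x * (E * (|β| / 2) * K₀ * N * (x * m)) := by ring
        _ ≤ E * x ^ 2 * |Y x| + 1 * (E * (|β| / 2) * K₀ * N * (x * m)) := by gcongr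
        _ = _ := by ring
    have t2 : |x * ((x * A₂ x + β) * T x)| ≤ (E + |β|) * K₀ * N * (x * m) := by
      rw [abs_mul, abs_mul, abs_of_pos hx0]
      calc _ ≤ x * ((E + |β|) * (K₀ * N * m)) := by
            gcongr
            exact (abs_add_le _ _).trans (by gcongr; exact hA₂ x hx)
        _ = _ := by ring
    have t3 : |(x ^ 2 * A₃ x - a) * P x| ≤ E * K₀ * N * (x * m) := by
      rw [abs_mul]
      calc _ ≤ E * x ^ 2 * (K₀ * N * m) := by
            gcongr
            exact hA₃ x hx
        _ = x * (E * K₀ * N * (x * m)) := by ring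
        _ ≤ 1 * (E * K₀ * N * (x * m)) := by gcongr
        _ = _ := by ring
    have t4 : 0 ≤ K₁ * (1 + |β| / 2) * N * (x * m) := by positivity
    rw [hid, ← hpow]
    refine (abs_add_three _ _ _).trans ?_
    simp only [hK₂]
    linarith
  have hYR : |Y R| ≤ K₂ * N * R ^ γ := by
    have hp : R * R ^ (1 / 2 + s) = R ^ (3 / 2 + s) := by
      rw [mul_comm, ← Real.rpow_add_one hR.ne']; ring_nf
    have hle : R ^ (3 / 2 + s) ≤ R ^ γ :=
      Real.rpow_le_rpow_of_exponent_ge hR (by linarith) (by simp only [hγ]; linarith)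
    calc |Y R| ≤ |R * Q R| + |β / 2 * P R| := abs_sub _ _
      _ = R * |Q R| + |β| / 2 * |P R| := by
          rw [abs_mul, abs_mul, abs_of_pos hR, abs_div, abs_two]
      _ ≤ R * (K₁ * N * R ^ (1 / 2 + s)) + |β| / 2 * (K₁ * N * R ^ (3 / 2 + s)) := by gcongr
      _ = K₁ * (1 + |β| / 2) * N * R ^ (3 / 2 + s) := by rw [← hp]; ring
      _ ≤ K₂ * N * R ^ γ := by
          gcongr
          simp only [hK₂]
          have : 0 ≤ E * (|β| / 2) * K₀ + (E + |β|) * K₀ + E * K₀ := by positivity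
          linarith
  have hγα : γ ≤ α := by simp only [hγ, hα]; linarith
  have hγ2 : γ ≤ 2 := by simp only [hγ]; linarith
  have hYb : ∀ x ∈ Ioo 0 R, |Y x| ≤ 4 * K₂ * N * x ^ γ := by
    intro x hx
    rw [abs_le']
    constructor
    · refine le_rpow_of_singular_ode hγα hγ2 hE.le hK₂0 hN hR4 hER hYc hYd ?_
        ((le_abs_self _).trans hYR) hx
      intro y hy
      linarith [(abs_le.1 (herr y hy)).1]
    · refine le_rpow_of_singular_ode (Y := fun x => -Y x) (Y' := fun x => -Y' x)
        hγα hγ2 hE.le hK₂0 hN hR4 hER hYc.neg (fun y hy => (hYd y hy).neg) ?_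
        ((neg_le_abs _).trans hYR) hx
      intro y hy
      rw [abs_neg]
      linarith [(abs_le.1 (herr y hy)).2]
  have hPγ : ∀ x ∈ Ioo 0 R, |P x| ≤ K₃ * N * x ^ γ := by
    intro x hx
    have hg := abs_le_of_abs_deriv_le_rpow (g := fun x => x ^ (-β) * P x)
      (g' := fun x => -β * x ^ (-β - 1) * P x + x ^ (-β) * (2 * Q x - 2 * T x))
      (R := R) (A := 2 * (4 * K₂ + K₀) * N) hq0
      (fun y hy => (Real.hasDerivAt_rpow_const (Or.inl hy.1.ne')).mul (hP y hy))
      (by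
        intro y hy
        have hy0 := hy.1
        have e1 : y ^ (-β) = y * y ^ (-β - 1) := by
          rw [mul_comm, ← Real.rpow_add_one hy0.ne']; ring_nf
        have e2 : -β * y ^ (-β - 1) * P y + y ^ (-β) * (2 * Q y - 2 * T y)
            = y ^ (-β - 1) * (2 * (Y y - y * T y)) := by
          rw [e1]; simp only [hY]; ring
        have e3 : y ^ (q - 1) = y ^ (-β - 1) * y ^ γ := by
          rw [← Real.rpow_add hy0]; simp only [hq]; ring_nf
        have e4 : |y * T y| ≤ K₀ * N * y ^ γ := by
          rw [abs_mul, abs_of_pos hy0]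
          calc y * |T y| ≤ y * (K₀ * N * y ^ ((3 : ℝ) / 2)) := by gcongr; exact hTb y hy
            _ = K₀ * N * (y ^ ((3 : ℝ) / 2) * y) := by ring
            _ = K₀ * N * y ^ ((3 : ℝ) / 2 + 1) := by rw [Real.rpow_add_one hy0.ne']
            _ ≤ K₀ * N * y ^ γ := by
                gcongr K₀ * N * ?_
                exact Real.rpow_le_rpow_of_exponent_ge hy0 (by linarith [hy.2]) (by linarith)
        rw [e2, abs_mul, abs_mul, abs_two, abs_of_pos (Real.rpow_pos_of_pos hy0 _), e3]
        calc _ ≤ y ^ (-β - 1) * (2 * (4 * K₂ * N * y ^ γ + K₀ * N * y ^ γ)) := by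
              gcongr
              exact (abs_sub _ _).trans (add_le_add (hYb y hy) e4)
          _ = _ := by ring)
      (by
        have hb : Tendsto (fun y : ℝ => K₀ * N * y ^ (d / 2)) (𝓝[>] 0) (𝓝 0) := by
          have h : Continuous (fun y : ℝ => K₀ * N * y ^ (d / 2)) :=
            continuous_const.mul (Real.continuous_rpow_const (by positivity))
          have := (h.tendsto 0).mono_left (nhdsWithin_le_nhds (s := Ioi (0:ℝ)))
          simpa [Real.zero_rpow (by positivity : d / 2 ≠ 0)] using this
        refine squeeze_zero_norm' ?_ hb
        filter_upwards [Ioo_mem_nhdsGT hR] with y hy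
        have hy0 := hy.1
        rw [Real.norm_eq_abs, abs_mul, abs_of_pos (Real.rpow_pos_of_pos hy0 _)]
        calc _ ≤ y ^ (-β) * (K₀ * N * y ^ ((3 : ℝ) / 2)) := by gcongr; exact hPb y hy
          _ = K₀ * N * (y ^ (-β) * y ^ ((3 : ℝ) / 2)) := by ring
          _ = _ := by rw [← Real.rpow_add hy0]; simp only [hβ]; ring_nf)
      hx
    have hx0 := hx.1
    rw [abs_mul, abs_of_pos (Real.rpow_pos_of_pos hx0 _)] at hg
    have e : x ^ q = x ^ (-β) * x ^ γ := by
      rw [← Real.rpow_add hx0]; simp only [hq]; ring_nf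
    rw [e] at hg
    refine le_of_mul_le_mul_left (hg.trans_eq ?_) (Real.rpow_pos_of_pos hx0 (-β))
    simp only [hK₃]; ring
  intro x hx
  have hx0 := hx.1
  constructor
  · refine (hPγ x hx).trans ?_
    have : 0 < 4 * K₂ + |β| / 2 * K₃ := by positivity
    have : K₃ ≤ K₃ + (4 * K₂ + |β| / 2 * K₃) := by linarith
    gcongr
  · have e : x ^ γ = x * x ^ (1 / 2 + s / 2) := by
      rw [mul_comm, ← Real.rpow_add_one hx0.ne']; simp only [hγ]; ring_nf
    have h1 := hPγ x hx
    have h2 := hYb x hx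
    rw [e] at h1 h2
    have h3 : x * |Q x| ≤ x * ((4 * K₂ + |β| / 2 * K₃) * N * x ^ (1 / 2 + s / 2)) := by
      have : x * Q x = Y x + β / 2 * P x := by simp only [hY]; ring
      calc x * |Q x| = |Y x + β / 2 * P x| := by rw [← this, abs_mul, abs_of_pos hx0]
        _ ≤ |Y x| + |β| / 2 * |P x| := by
            refine (abs_add_le _ _).trans ?_
            rw [abs_mul, abs_div, abs_two]
        _ ≤ 4 * K₂ * N * (x * x ^ (1 / 2 + s / 2))
            + |β| / 2 * (K₃ * N * (x * x ^ (1 / 2 + s / 2))) := by gcongr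
        _ = _ := by ring
    have : 4 * K₂ + |β| / 2 * K₃ ≤ K₃ + (4 * K₂ + |β| / 2 * K₃) := by linarith
    refine (le_of_mul_le_mul_left h3 hx0).trans ?_
    gcongr

theorem abs_mul_sub_mul_le {f f₀ g g₀ e₁ e₂ ε : ℝ} (he₂ : 0 ≤ e₂)
    (hε1 : ε ≤ 1) (hf : |f - f₀| ≤ e₁ * ε) (hg : |g - g₀| ≤ e₂ * ε) :
    |f * g - f₀ * g₀| ≤ (e₁ * (|g₀| + e₂) + |f₀| * e₂) * ε := by
  have hgb : |g| ≤ |g₀| + e₂ := by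
    have h1 : |g| ≤ |g₀| + |g - g₀| := by
      calc |g| = |g₀ + (g - g₀)| := by ring_nf
        _ ≤ _ := abs_add_le _ _
    have h2 : e₂ * ε ≤ e₂ := mul_le_of_le_one_right he₂ hε1
    linarith
  have : f * g - f₀ * g₀ = (f - f₀) * g + f₀ * (g - g₀) := by ring
  rw [this]
  refine (abs_add_le _ _).trans ?_
  rw [abs_mul, abs_mul]
  have hp : |f - f₀| * |g| ≤ (e₁ * ε) * (|g₀| + e₂) :=
    mul_le_mul hf hgb (abs_nonneg _) ((abs_nonneg _).trans hf)
  have hq : |f₀| * |g - g₀| ≤ |f₀| * (e₂ * ε) := by gcongr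
  linarith

/-- Asymptotics of the coefficients of the reduced system, deduced from
`r' = -2kw` with `w = r²/l² + O(1)` and `k = 1/2 + O(x³)`. -/
theorem exists_coefficient_bounds (a l b c m : ℝ) (hl : 0 < l) (hb : 0 < b) (hc : 0 < c)
    (hm : 0 < m) :
    ∃ E > 0, ∀ R : ℝ, R ≤ 1 → ∀ r k g w : ℝ → ℝ,
      (∀ x ∈ Ioo 0 R, HasDerivAt r (-2 * (k x * w x)) x) →
      (∀ x ∈ Ioo 0 R, 0 < r x) →
      (∀ x ∈ Ioo 0 R, c⁻¹ * x⁻¹ ≤ r x ∧ r x ≤ c * x⁻¹) →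
      (∀ x ∈ Ioo 0 R, |k x - 1 / 2| ≤ b * x ^ 3) →
      (∀ x ∈ Ioo 0 R, |g x - 1 / 2| ≤ b * x ^ 3) →
      (∀ x ∈ Ioo 0 R, |w x - r x ^ 2 / l ^ 2| ≤ m) →
      ∀ x ∈ Ioo 0 R, |x * (2 * (k x + g x) * w x / r x) - 2| ≤ E * x ^ 2 ∧
        |x * (-2 * g x * w x / r x)| ≤ E ∧
        |x ^ 2 * (4 * k x * g x * w x * a / l ^ 2) - a| ≤ E * x ^ 2 := by
  obtain ⟨eq, heq⟩ : ∃ e, e = m * c ^ 2 := ⟨_, rfl⟩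
  have heq0 : 0 < eq := by rw [heq]; positivity
  obtain ⟨ey, hey⟩ : ∃ e, e = b * (|1 / l ^ 2| + eq) + |1 / 2| * eq := ⟨_, rfl⟩
  have hey0 : 0 < ey := by rw [hey]; positivity
  obtain ⟨er, her⟩ : ∃ e, e = l ^ 2 * (2 * ey / 3) * c := ⟨_, rfl⟩
  have her0 : 0 < er := by rw [her]; positivity
  obtain ⟨ez, hez⟩ : ∃ e, e = eq * (|l ^ 2| + er) + |1 / l ^ 2| * er := ⟨_, rfl⟩
  have hez0 : 0 < ez := by rw [hez]; positivity
  obtain ⟨e₁, he₁⟩ : ∃ e, e = 2 * b * (|1| + ez) + |1| * ez := ⟨_, rfl⟩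
  have he₁0 : 0 < e₁ := by rw [he₁]; positivity
  obtain ⟨e₂, he₂⟩ : ∃ e, e = b * (|1| + ez) + |1 / 2| * ez := ⟨_, rfl⟩
  have he₂0 : 0 < e₂ := by rw [he₂]; positivity
  obtain ⟨e₃, he₃⟩ : ∃ e, e = b * (|l ^ 2| + er) + |1 / 2| * er := ⟨_, rfl⟩
  have he₃0 : 0 < e₃ := by rw [he₃]; positivity
  obtain ⟨e₄, he₄⟩ : ∃ e, e = e₂ * (|1 / 2 * l ^ 2| + e₃) + |1 / 2 * 1| * e₃ := ⟨_, rfl⟩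
  have he₄0 : 0 < e₄ := by rw [he₄]; positivity
  refine ⟨2 * e₁ + (2 * e₂ + 1) + 4 * |a| / l ^ 2 * e₄, by positivity, ?_⟩
  intro R hR r k g w hr hr0 hrc hk hg hw
  have hx1 : ∀ x ∈ Ioo 0 R, x ≤ 1 := fun x hx => hx.2.le.trans hR
  have hx2 : ∀ x ∈ Ioo 0 R, x ^ 2 ≤ 1 := fun x hx => pow_le_one₀ hx.1.le (hx1 x hx)
  have hinv : ∀ x ∈ Ioo 0 R, (r x)⁻¹ ≤ c * x := by
    intro x hx
    have hx0 := hx.1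
    rw [inv_le_comm₀ (hr0 x hx) (by positivity)]
    rw [mul_inv]
    exact (hrc x hx).1
  have hcube : ∀ x ∈ Ioo 0 R, b * x ^ 3 ≤ b * x ^ 2 := by
    intro x hx
    have hx0 := hx.1
    gcongr ?_ * ?_
    exact pow_le_pow_of_le_one hx0.le (hx1 x hx) (by norm_num)
  have hk' : ∀ x ∈ Ioo 0 R, |k x - 1 / 2| ≤ b * x ^ 2 := fun x hx =>
    (hk x hx).trans (hcube x hx)
  have hg' : ∀ x ∈ Ioo 0 R, |g x - 1 / 2| ≤ b * x ^ 2 := fun x hx =>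
    (hg x hx).trans (hcube x hx)
  have hq : ∀ x ∈ Ioo 0 R, |w x / r x ^ 2 - 1 / l ^ 2| ≤ eq * x ^ 2 := by
    intro x hx
    have h0 := hr0 x hx
    have e : w x / r x ^ 2 - 1 / l ^ 2 = (w x - r x ^ 2 / l ^ 2) * ((r x)⁻¹) ^ 2 := by
      field_simp
    rw [e, abs_mul, abs_of_nonneg (a := ((r x)⁻¹) ^ 2) (by positivity), heq]
    calc _ ≤ m * (c * x) ^ 2 := by
          gcongr
          · exact hw x hx
          · exact hinv x hx
      _ = _ := by ring
  have hkq : ∀ x ∈ Ioo 0 R, |k x * (w x / r x ^ 2) - 1 / 2 * (1 / l ^ 2)| ≤ ey * x ^ 2 := by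
    intro x hx
    rw [hey]
    exact abs_mul_sub_mul_le heq0.le (hx2 x hx) (hk' x hx) (hq x hx)
  have hy : ∀ x ∈ Ioo 0 R, |(r x)⁻¹ - x / l ^ 2| ≤ 2 * ey / 3 * x ^ 3 := by
    intro x hx
    have := abs_le_of_abs_deriv_le_rpow (g := fun x => (r x)⁻¹ - x / l ^ 2)
      (g' := fun x => -(-2 * (k x * w x)) / r x ^ 2 - 1 / l ^ 2) (A := 2 * ey) (q := 3) (R := R)
      (by norm_num)
      (fun y hy => ((hr y hy).inv (hr0 y hy).ne').sub ((hasDerivAt_id y).div_const _))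
      (by
        intro y hy
        have h0 := hr0 y hy
        have e : -(-2 * (k y * w y)) / r y ^ 2 - 1 / l ^ 2
            = 2 * (k y * (w y / r y ^ 2) - 1 / 2 * (1 / l ^ 2)) := by ring
        rw [e, abs_mul, abs_two]
        have := hkq y hy
        norm_num at this ⊢
        linarith)
      (by
        have hb : Tendsto (fun y : ℝ => c * y + y / l ^ 2) (𝓝[>] 0) (𝓝 0) := by
          have h : Continuous (fun y : ℝ => c * y + y / l ^ 2) := by fun_prop
          have := (h.tendsto 0).mono_left (nhdsWithin_le_nhds (s := Ioi (0:ℝ)))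
          simpa using this
        refine squeeze_zero_norm' ?_ hb
        filter_upwards [Ioo_mem_nhdsGT (hx.1.trans hx.2)] with y hy
        have hy0 := hy.1
        rw [Real.norm_eq_abs]
        refine (abs_sub _ _).trans ?_
        rw [abs_of_pos (inv_pos.2 (hr0 y hy)), abs_of_pos (by positivity : 0 < y / l ^ 2)]
        linarith [hinv y hy])
      hx
    norm_num at this ⊢
    exact_mod_cast this
  have hR1 : ∀ x ∈ Ioo 0 R, |x * r x - l ^ 2| ≤ er * x ^ 2 := by
    intro x hx
    have h0 := hr0 x hx
    have hx0 := hx.1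
    have e : x * r x - l ^ 2 = -(l ^ 2 * ((r x)⁻¹ - x / l ^ 2) * r x) := by field_simp; ring
    rw [e, abs_neg, abs_mul, abs_mul, abs_of_pos h0, abs_of_pos (by positivity : 0 < l ^ 2), her]
    calc _ ≤ l ^ 2 * (2 * ey / 3 * x ^ 3) * (c * x⁻¹) := by
          gcongr
          · exact hy x hx
          · exact (hrc x hx).2
      _ = _ := by field_simp
  intro x hx
  have h0 := hr0 x hx
  have hx0 := hx.1
  have hxx := hx2 x hx
  have hz : |x * w x / r x - 1| ≤ ez * x ^ 2 := by
    have := abs_mul_sub_mul_le her0.le hxx (hq x hx) (hR1 x hx)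
    rw [← hez] at this
    have e : w x / r x ^ 2 * (x * r x) - 1 / l ^ 2 * l ^ 2 = x * w x / r x - 1 := by field_simp
    rwa [e] at this
  have h1 : |(k x + g x) * (x * w x / r x) - 1 * 1| ≤ e₁ * x ^ 2 := by
    rw [he₁]
    refine abs_mul_sub_mul_le hez0.le hxx ?_ hz
    have e : k x + g x - 1 = (k x - 1 / 2) + (g x - 1 / 2) := by ring
    rw [e]
    refine (abs_add_le _ _).trans ?_
    linarith [hk' x hx, hg' x hx]
  have h2 : |g x * (x * w x / r x) - 1 / 2 * 1| ≤ e₂ * x ^ 2 := by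
    rw [he₂]
    exact abs_mul_sub_mul_le hez0.le hxx (hg' x hx) hz
  have h3 : |k x * (x * r x) - 1 / 2 * l ^ 2| ≤ e₃ * x ^ 2 := by
    rw [he₃]
    exact abs_mul_sub_mul_le her0.le hxx (hk' x hx) (hR1 x hx)
  have h4 : |g x * (x * w x / r x) * (k x * (x * r x)) - 1 / 2 * 1 * (1 / 2 * l ^ 2)|
      ≤ e₄ * x ^ 2 := by
    rw [he₄]
    exact abs_mul_sub_mul_le he₃0.le hxx h2 h3
  have hpos4 : 0 ≤ 4 * |a| / l ^ 2 * e₄ := by positivity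
  refine ⟨?_, ?_, ?_⟩
  · have e : x * (2 * (k x + g x) * w x / r x) - 2
        = 2 * ((k x + g x) * (x * w x / r x) - 1 * 1) := by ring
    rw [e, abs_mul, abs_two]
    calc _ ≤ 2 * (e₁ * x ^ 2) := by gcongr
      _ = 2 * e₁ * x ^ 2 := by ring
      _ ≤ _ := by gcongr; linarith
  · have e : x * (-2 * g x * w x / r x) = -(2 * (g x * (x * w x / r x) - 1 / 2 * 1) + 1) := by
      ring
    rw [e, abs_neg]
    refine (abs_add_le _ _).trans ?_
    rw [abs_mul, abs_two, abs_one]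
    have : e₂ * x ^ 2 ≤ e₂ := mul_le_of_le_one_right he₂0.le hxx
    linarith
  · have e : x ^ 2 * (4 * k x * g x * w x * a / l ^ 2) - a = 4 * a / l ^ 2 *
        (g x * (x * w x / r x) * (k x * (x * r x)) - 1 / 2 * 1 * (1 / 2 * l ^ 2)) := by
      field_simp
      ring
    rw [e, abs_mul, abs_div, abs_mul, abs_of_pos (by positivity : 0 < l ^ 2),
      abs_of_pos (by norm_num : (0:ℝ) < 4)]
    calc _ ≤ 4 * |a| / l ^ 2 * (e₄ * x ^ 2) := by gcongr
      _ = 4 * |a| / l ^ 2 * e₄ * x ^ 2 := by ring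
      _ ≤ _ := by gcongr; linarith

theorem abs_le_of_integral_le {f f' e : ℝ → ℝ} {u₀ u A D N : ℝ} (hA : 0 ≤ A) (hN : 0 ≤ N)
    (he : ContinuousOn e (Ico u₀ u)) (he0 : ∀ y ∈ Ico u₀ u, 0 ≤ e y)
    (hint : ∀ v ∈ Ioo u₀ u, ∫ y in Ioc u₀ v, e y ≤ D * N ^ 2)
    (hf' : ContinuousOn f' (Ioo u₀ u)) (hf : ∀ y ∈ Ioo u₀ u, HasDerivAt f (f' y) y)
    (hfe : ∀ y ∈ Ioo u₀ u, f y ^ 2 ≤ A * ((u - y) / 2) ^ 4 * e y)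
    (hfe' : ∀ y ∈ Ioo u₀ u, f' y ^ 2 ≤ A * ((u - y) / 2) ^ 2 * e y)
    {v : ℝ} (hv : v ∈ Ioo u₀ u) :
    |f v| ≤ √(3 * A * D) * N * ((u - v) / 2) ^ ((3 : ℝ) / 2) := by
  set h := (u - v) / 2 with hh
  have hh0 : 0 < h := by linarith [hv.2]
  have hsub : Icc v (v + h) ⊆ Ioo u₀ u := fun y hy =>
    ⟨hv.1.trans_le hy.1, by linarith [hy.2, hv.2]⟩
  have hsub' : Icc u₀ (v + h) ⊆ Ico u₀ u := fun y hy => ⟨hy.1, by linarith [hy.2, hv.2]⟩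
  have hsubc : Icc v (v + h) ⊆ Ico u₀ u := hsub.trans Ioo_subset_Ico_self
  have hvh : v ≤ v + h := by linarith
  have hei : IntegrableOn e (Ioc u₀ (v + h)) :=
    ((he.mono hsub').integrableOn_Icc).mono_set Ioc_subset_Icc_self
  have h1 := mul_sq_le_integral_sq_add_sq hh0 (hf'.mono hsub) fun y hy => hf y (hsub hy)
  have h2 : ∫ y in v..(v + h), (2 * f y ^ 2 + h ^ 2 * f' y ^ 2)
      ≤ ∫ y in v..(v + h), 3 * A * h ^ 4 * e y := by
    have hfc : ContinuousOn f (Icc v (v + h)) :=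
      fun y hy => (hf y (hsub hy)).continuousAt.continuousWithinAt
    have hfc' := hf'.mono hsub
    have hec := he.mono hsubc
    apply intervalIntegral.integral_mono_on hvh
    · apply ContinuousOn.intervalIntegrable
      rw [uIcc_of_le hvh]
      fun_prop
    · apply ContinuousOn.intervalIntegrable
      rw [uIcc_of_le hvh]
      fun_prop
    intro y hy
    have hyu := hsub hy
    have hx : (u - y) / 2 ≤ h := by linarith [hy.1]
    have hx0 : 0 ≤ (u - y) / 2 := by linarith [hyu.2]
    have hey := he0 y (hsubc hy)
    have i1 : f y ^ 2 ≤ A * h ^ 4 * e y := (hfe y hyu).trans (by gcongr)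
    have i2 : f' y ^ 2 ≤ A * h ^ 2 * e y := (hfe' y hyu).trans (by gcongr)
    calc 2 * f y ^ 2 + h ^ 2 * f' y ^ 2 ≤ 2 * (A * h ^ 4 * e y) + h ^ 2 * (A * h ^ 2 * e y) := by
          gcongr
      _ = _ := by ring
  have h3 : ∫ y in v..(v + h), e y ≤ D * N ^ 2 := by
    rw [intervalIntegral.integral_of_le hvh]
    refine le_trans ?_ (hint (v + h) (hsub ⟨hvh, le_rfl⟩))
    apply setIntegral_mono_set hei
    · rw [EventuallyLE, ae_restrict_iff' measurableSet_Ioc]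
      exact Eventually.of_forall fun y hy => he0 y (hsub' (Ioc_subset_Icc_self hy))
    · exact (Ioc_subset_Ioc_left hv.1.le).eventuallyLE
  rw [intervalIntegral.integral_const_mul] at h2
  have h4 : h * f v ^ 2 ≤ h * (3 * A * D * N ^ 2 * h ^ 3) := by
    calc h * f v ^ 2 ≤ 3 * A * h ^ 4 * (D * N ^ 2) :=
          (h1.trans h2).trans (by gcongr)
      _ = _ := by ring
  have h5 := le_of_mul_le_mul_left h4 hh0
  have e1 : √(h ^ 3) = h ^ ((3 : ℝ) / 2) := by
    rw [Real.sqrt_eq_rpow, ← Real.rpow_natCast, ← Real.rpow_mul hh0.le]; norm_num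
  rw [← Real.sqrt_sq_eq_abs, ← e1]
  refine (Real.sqrt_le_sqrt h5).trans_eq ?_
  rw [Real.sqrt_mul' _ (by positivity), Real.sqrt_mul' _ (by positivity), Real.sqrt_sq hN]

theorem convex_Tri (u₀ δ : ℝ) : Convex ℝ (Tri u₀ δ) := by
  have h1 : Convex ℝ {p : ℝ × ℝ | u₀ ≤ p.2} :=
    convex_halfSpace_ge (LinearMap.snd ℝ ℝ ℝ).isLinear u₀
  have h2 : Convex ℝ {p : ℝ × ℝ | p.2 - p.1 < 0} :=
    convex_halfSpace_lt (LinearMap.snd ℝ ℝ ℝ - LinearMap.fst ℝ ℝ ℝ).isLinear 0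
  have h3 : Convex ℝ {p : ℝ × ℝ | p.1 ≤ u₀ + δ} :=
    convex_halfSpace_le (LinearMap.fst ℝ ℝ ℝ).isLinear _
  convert h1.inter (h2.inter h3) using 1
  ext p
  simp [Tri]

theorem uniqueDiffOn_Tri {u₀ δ : ℝ} (hδ : 0 < δ) : UniqueDiffOn ℝ (Tri u₀ δ) := by
  refine uniqueDiffOn_convex (convex_Tri u₀ δ) ?_
  have hopen : IsOpen {p : ℝ × ℝ | u₀ < p.2 ∧ p.2 < p.1 ∧ p.1 < u₀ + δ} :=
    (isOpen_lt continuous_const continuous_snd).inter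
      ((isOpen_lt continuous_snd continuous_fst).inter
        (isOpen_lt continuous_fst continuous_const))
  refine ⟨(u₀ + 2 * δ / 3, u₀ + δ / 3), ?_⟩
  rw [mem_interior]
  refine ⟨_, fun p hp => ⟨hp.1.le, hp.2.1, hp.2.2.le⟩, hopen, ?_, ?_, ?_⟩ <;> dsimp only <;> linarith

/-- The partial derivative in `u` relative to a set. -/
def dwu (S : Set (ℝ × ℝ)) (f : ℝ × ℝ → ℝ) (p : ℝ × ℝ) : ℝ := fderivWithin ℝ f S p (1, 0)

/-- The partial derivative in `v` relative to a set. -/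
def dwv (S : Set (ℝ × ℝ)) (f : ℝ × ℝ → ℝ) (p : ℝ × ℝ) : ℝ := fderivWithin ℝ f S p (0, 1)

section Slices

variable {u₀ δ : ℝ} {f : ℝ × ℝ → ℝ} {p : ℝ × ℝ}

theorem contDiffOn_dwu (hδ : 0 < δ) (hf : ContDiffOn ℝ 2 f (Tri u₀ δ)) :
    ContDiffOn ℝ 1 (dwu (Tri u₀ δ) f) (Tri u₀ δ) :=
  (hf.fderivWithin (uniqueDiffOn_Tri hδ) (by norm_num)).clm_apply contDiffOn_const

theorem contDiffOn_dwv (hδ : 0 < δ) (hf : ContDiffOn ℝ 2 f (Tri u₀ δ)) :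
    ContDiffOn ℝ 1 (dwv (Tri u₀ δ) f) (Tri u₀ δ) :=
  (hf.fderivWithin (uniqueDiffOn_Tri hδ) (by norm_num)).clm_apply contDiffOn_const

theorem continuousOn_dwv (hδ : 0 < δ) (hf : ContDiffOn ℝ 1 f (Tri u₀ δ)) :
    ContinuousOn (dwv (Tri u₀ δ) f) (Tri u₀ δ) :=
  (hf.continuousOn_fderivWithin (uniqueDiffOn_Tri hδ) (by norm_num)).clm_apply continuousOn_const

theorem hasDerivWithinAt_slice_fst (hf : ContDiffOn ℝ 1 f (Tri u₀ δ)) (hp : p ∈ Tri u₀ δ) :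
    HasDerivWithinAt (fun x => f (x, p.2)) (dwu (Tri u₀ δ) f p) (Ioc p.2 (u₀ + δ)) p.1 := by
  have h1 : HasFDerivWithinAt f (fderivWithin ℝ f (Tri u₀ δ) p) (Tri u₀ δ) (p.1, p.2) :=
    (hf.differentiableOn (by norm_num) p hp).hasFDerivWithinAt
  have h2 : HasDerivWithinAt (fun x : ℝ => (x, p.2)) (1, 0) (Ioc p.2 (u₀ + δ)) p.1 :=
    ((hasDerivAt_id _).prodMk (hasDerivAt_const _ _)).hasDerivWithinAt
  have h3 : MapsTo (fun x : ℝ => (x, p.2)) (Ioc p.2 (u₀ + δ)) (Tri u₀ δ) :=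
    fun x hx => ⟨hp.1, hx.1, hx.2⟩
  exact h1.comp_hasDerivWithinAt p.1 h2 h3

theorem hasDerivWithinAt_slice_snd (hf : ContDiffOn ℝ 1 f (Tri u₀ δ)) (hp : p ∈ Tri u₀ δ) :
    HasDerivWithinAt (fun y => f (p.1, y)) (dwv (Tri u₀ δ) f p) (Ico u₀ p.1) p.2 := by
  have h1 : HasFDerivWithinAt f (fderivWithin ℝ f (Tri u₀ δ) p) (Tri u₀ δ) (p.1, p.2) :=
    (hf.differentiableOn (by norm_num) p hp).hasFDerivWithinAt
  have h2 : HasDerivWithinAt (fun y : ℝ => (p.1, y)) (0, 1) (Ico u₀ p.1) p.2 :=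
    ((hasDerivAt_const _ _).prodMk (hasDerivAt_id _)).hasDerivWithinAt
  have h3 : MapsTo (fun y : ℝ => (p.1, y)) (Ico u₀ p.1) (Tri u₀ δ) :=
    fun y hy => ⟨hy.1, hy.2, hp.2.2⟩
  exact h1.comp_hasDerivWithinAt p.2 h2 h3

theorem hasDerivAt_slice_fst (hf : ContDiffOn ℝ 1 f (Tri u₀ δ)) (hp : p ∈ Tri u₀ δ)
    (hpu : p.1 < u₀ + δ) : HasDerivAt (fun x => f (x, p.2)) (dwu (Tri u₀ δ) f p) p.1 :=
  (hasDerivWithinAt_slice_fst hf hp).hasDerivAt (Ioc_mem_nhds hp.2.1 hpu)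

theorem hasDerivAt_slice_snd (hf : ContDiffOn ℝ 1 f (Tri u₀ δ)) (hp : p ∈ Tri u₀ δ)
    (hpv : u₀ < p.2) : HasDerivAt (fun y => f (p.1, y)) (dwv (Tri u₀ δ) f p) p.2 :=
  (hasDerivWithinAt_slice_snd hf hp).hasDerivAt (Ico_mem_nhds hpv hp.2.1)

theorem pdu_eq_dwu (hf : ContDiffOn ℝ 1 f (Tri u₀ δ)) (hp : p ∈ Tri u₀ δ)
    (hpu : p.1 < u₀ + δ) : pdu f p = dwu (Tri u₀ δ) f p :=
  (hasDerivAt_slice_fst hf hp hpu).deriv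

theorem pdv_eq_dwv (hf : ContDiffOn ℝ 1 f (Tri u₀ δ)) (hp : p ∈ Tri u₀ δ)
    (hpv : u₀ < p.2) : pdv f p = dwv (Tri u₀ δ) f p :=
  (hasDerivAt_slice_snd hf hp hpv).deriv

theorem abs_deriv_le_of_hasDerivWithinAt {g : ℝ → ℝ} {g' x : ℝ} {s : Set ℝ}
    (hs : UniqueDiffWithinAt ℝ s x) (hg : HasDerivWithinAt g g' s x) : |deriv g x| ≤ |g'| := by
  by_cases h : DifferentiableAt ℝ g x
  · exact (congrArg abs (hs.eq_deriv _ h.hasDerivAt.hasDerivWithinAt hg)).le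
  · simp [deriv_zero_of_not_differentiableAt h]

theorem abs_pdu_le (hf : ContDiffOn ℝ 1 f (Tri u₀ δ)) (hp : p ∈ Tri u₀ δ) :
    |pdu f p| ≤ |dwu (Tri u₀ δ) f p| :=
  abs_deriv_le_of_hasDerivWithinAt (uniqueDiffOn_Ioc _ _ _ ⟨hp.2.1, hp.2.2⟩)
    (hasDerivWithinAt_slice_fst hf hp)

theorem abs_pdv_le (hf : ContDiffOn ℝ 1 f (Tri u₀ δ)) (hp : p ∈ Tri u₀ δ) :
    |pdv f p| ≤ |dwv (Tri u₀ δ) f p| :=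
  abs_deriv_le_of_hasDerivWithinAt (uniqueDiffOn_Ico _ _ _ ⟨hp.1, hp.2.1⟩)
    (hasDerivWithinAt_slice_snd hf hp)

theorem pdv_pdu_eq (hδ : 0 < δ) (hf : ContDiffOn ℝ 2 f (Tri u₀ δ)) (hp : p ∈ Tri u₀ δ)
    (hpu : p.1 < u₀ + δ) (hpv : u₀ < p.2) :
    pdv (fun q => pdu f q) p = dwv (Tri u₀ δ) (dwu (Tri u₀ δ) f) p := by
  rw [← pdv_eq_dwv (contDiffOn_dwu hδ hf) hp hpv]
  refine EventuallyEq.deriv_eq ?_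
  filter_upwards [Ioo_mem_nhds hpv hp.2.1] with y hy
  exact pdu_eq_dwu (p := (p.1, y)) (hf.of_le (by norm_num)) ⟨hy.1.le, hy.2, hp.2.2⟩ hpu

theorem Td_eq (hf : ContDiffOn ℝ 1 f (Tri u₀ δ)) (hp : p ∈ Tri u₀ δ)
    (hpu : p.1 < u₀ + δ) (hpv : u₀ < p.2) :
    Td f p = dwu (Tri u₀ δ) f p + dwv (Tri u₀ δ) f p := by
  rw [Td, pdu_eq_dwu hf hp hpu, pdv_eq_dwv hf hp hpv]

theorem pdv_Td_eq (hδ : 0 < δ) (hf : ContDiffOn ℝ 2 f (Tri u₀ δ)) (hp : p ∈ Tri u₀ δ)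
    (hpu : p.1 < u₀ + δ) (hpv : u₀ < p.2) :
    pdv (fun q => Td f q) p =
      dwv (Tri u₀ δ) (fun q => dwu (Tri u₀ δ) f q + dwv (Tri u₀ δ) f q) p := by
  rw [← pdv_eq_dwv ((contDiffOn_dwu hδ hf).add (contDiffOn_dwv hδ hf)) hp hpv]
  refine EventuallyEq.deriv_eq ?_
  filter_upwards [Ioo_mem_nhds hpv hp.2.1] with y hy
  exact Td_eq (p := (p.1, y)) (hf.of_le (by norm_num)) ⟨hy.1.le, hy.2, hp.2.2⟩ hpu hy.1

/-- A bound on the interior of `Tri u₀ δ` extends to its boundary points. -/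
theorem le_of_forall_interior {g : ℝ × ℝ → ℝ} (hf : ContinuousOn f (Tri u₀ δ))
    (hg : Continuous g)
    (h : ∀ q ∈ Tri u₀ δ, q.1 < u₀ + δ → u₀ < q.2 → |f q| ≤ g q) (hp : p ∈ Tri u₀ δ) :
    |f p| ≤ g p := by
  have hcurve : Tendsto (fun t : ℝ => (p.1 - t, p.2 + t)) (𝓝[>] 0) (𝓝 p) := by
    have hc : Continuous (fun t : ℝ => (p.1 - t, p.2 + t)) := by fun_prop
    simpa using (hc.tendsto 0).mono_left nhdsWithin_le_nhds
  have hin : ∀ᶠ t : ℝ in 𝓝[>] 0, (p.1 - t, p.2 + t) ∈ Tri u₀ δ ∧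
      p.1 - t < u₀ + δ ∧ u₀ < p.2 + t := by
    have : 0 < (p.1 - p.2) / 2 := by linarith [hp.2.1]
    filter_upwards [Ioo_mem_nhdsGT this] with t ht
    have h1 := hp.1
    have h2 := hp.2.2
    refine ⟨⟨?_, ?_, ?_⟩, ?_, ?_⟩ <;> (try dsimp only) <;> linarith [ht.1, ht.2]
  have hfl : Tendsto (fun t : ℝ => |f (p.1 - t, p.2 + t)|) (𝓝[>] 0) (𝓝 |f p|) :=
    ((hf p hp).tendsto.comp (tendsto_nhdsWithin_iff.2 ⟨hcurve, hin.mono fun t ht => ht.1⟩)).abs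
  refine le_of_tendsto_of_tendsto hfl ((hg.tendsto p).comp hcurve) ?_
  exact hin.mono fun t ht => h _ ht.1 ht.2.1 ht.2.2

end Slices

/-- The energy flux through constant-`u` lines controls `ψ` and `Tψ` by `ρ^{3/2}`. -/
theorem abs_le_of_energy_bound {l c D N u₀ δ : ℝ} {ϖ r ψ : ℝ × ℝ → ℝ} (hl : 0 < l) (hc : 0 < c)
    (hδ : 0 < δ) (hN : 0 < N) (hϖ : ContDiffOn ℝ 1 ϖ (Tri u₀ δ))
    (hr0 : ∀ p ∈ Tri u₀ δ, 0 < r p)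
    (hrd : ∀ p ∈ Tri u₀ δ, DifferentiableAt ℝ (fun y => r (p.1, y)) p.2)
    (hrc : ∀ p ∈ Tri u₀ δ, c⁻¹ * (rho p)⁻¹ ≤ r p)
    (hw : ∀ p ∈ Tri u₀ δ, 1 / (2 * l ^ 2) ≤ oneMinusMu l r ϖ p / (r p) ^ 2)
    (hψ : ContDiffOn ℝ 2 ψ (Tri u₀ δ))
    (hen : ∀ p ∈ Tri u₀ δ,
        (∫ y in Set.Ioc u₀ p.2,
          ((pdv (fun q => Td ψ q) (p.1, y)) ^ 2 + (pdv ψ (p.1, y)) ^ 2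
            + (ψ (p.1, y)) ^ 2 * oneMinusMu l r ϖ (p.1, y)
            + (Td ψ (p.1, y)) ^ 2 * oneMinusMu l r ϖ (p.1, y)) * (r (p.1, y)) ^ 2)
          ≤ D * N ^ 2) {p : ℝ × ℝ} (hp : p ∈ Tri u₀ δ) :
    |ψ p| ≤ √(3 * (c ^ 2 + 2 * l ^ 2 * c ^ 4) * D) * N * rho p ^ ((3 : ℝ) / 2) ∧
    |dwu (Tri u₀ δ) ψ p + dwv (Tri u₀ δ) ψ p| ≤
      √(3 * (c ^ 2 + 2 * l ^ 2 * c ^ 4) * D) * N * rho p ^ ((3 : ℝ) / 2) := by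
  set S := Tri u₀ δ with hS
  set A := c ^ 2 + 2 * l ^ 2 * c ^ 4 with hA
  have hψ1 : ContDiffOn ℝ 1 ψ S := hψ.of_le (by norm_num)
  set τ : ℝ × ℝ → ℝ := fun q => dwu S ψ q + dwv S ψ q with hτ
  have hτ1 : ContDiffOn ℝ 1 τ S := (contDiffOn_dwu hδ hψ).add (contDiffOn_dwv hδ hψ)
  have hw0 : ∀ q ∈ S, r q ^ 2 / (2 * l ^ 2) ≤ oneMinusMu l r ϖ q := by
    intro q hq
    have h0 := hr0 q hq
    have := hw q hq
    rw [le_div_iff₀ (by positivity)] at this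
    linarith [this, (by ring : 1 / (2 * l ^ 2) * r q ^ 2 = r q ^ 2 / (2 * l ^ 2))]
  have main : ∀ q ∈ S, q.1 < u₀ + δ → u₀ < q.2 →
      |ψ q| ≤ √(3 * A * D) * N * rho q ^ ((3 : ℝ) / 2) ∧
      |τ q| ≤ √(3 * A * D) * N * rho q ^ ((3 : ℝ) / 2) := by
    rintro ⟨u, v⟩ hq hu hv
    have hmem : ∀ y ∈ Ico u₀ u, (u, y) ∈ S := fun y hy => ⟨hy.1, hy.2, hq.2.2⟩
    have hmaps : MapsTo (fun y : ℝ => (u, y)) (Ico u₀ u) S := hmem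
    have hslice : ContinuousOn (fun y : ℝ => (u, y)) (Ico u₀ u) := by fun_prop
    set e : ℝ → ℝ := fun y => (dwv S τ (u, y) ^ 2 + dwv S ψ (u, y) ^ 2
      + ψ (u, y) ^ 2 * oneMinusMu l r ϖ (u, y) + τ (u, y) ^ 2 * oneMinusMu l r ϖ (u, y))
        * r (u, y) ^ 2 with he
    have hrcont : ContinuousOn (fun y => r (u, y)) (Ico u₀ u) := fun y hy =>
      (hrd (u, y) (hmem y hy)).continuousAt.continuousWithinAt
    have hec : ContinuousOn e (Ico u₀ u) := by
      have c1 := (continuousOn_dwv hδ hτ1).comp hslice hmaps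
      have c2 := (continuousOn_dwv hδ hψ1).comp hslice hmaps
      have c3 := hψ.continuousOn.comp hslice hmaps
      have c4 := hτ1.continuousOn.comp hslice hmaps
      have c5 := hϖ.continuousOn.comp hslice hmaps
      have c6 : ContinuousOn (fun y => oneMinusMu l r ϖ (u, y)) (Ico u₀ u) :=
        (continuousOn_const.sub ((continuousOn_const.mul c5).div hrcont
          fun y hy => (hr0 _ (hmem y hy)).ne')).add ((hrcont.pow 2).div_const _)
      exact ((((c1.pow 2).add (c2.pow 2)).add ((c3.pow 2).mul c6)).add
        ((c4.pow 2).mul c6)).mul (hrcont.pow 2)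
    have hwn : ∀ y ∈ Ico u₀ u, 0 ≤ oneMinusMu l r ϖ (u, y) := fun y hy =>
      (by positivity : 0 ≤ r (u, y) ^ 2 / (2 * l ^ 2)).trans (hw0 _ (hmem y hy))
    have he0 : ∀ y ∈ Ico u₀ u, 0 ≤ e y := by
      intro y hy
      have := hwn y hy
      positivity
    have hint : ∀ z ∈ Ioo u₀ u, ∫ y in Ioc u₀ z, e y ≤ D * N ^ 2 := by
      intro z hz
      refine le_trans (le_of_eq ?_) (hen (u, z) (hmem z ⟨hz.1.le, hz.2⟩))
      refine setIntegral_congr_fun measurableSet_Ioc fun y hy => ?_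
      have hy' := hmem y ⟨hy.1.le, hy.2.trans_lt hz.2⟩
      simp only [he]
      rw [pdv_Td_eq hδ hψ hy' hu hy.1, Td_eq hψ1 hy' hu hy.1, pdv_eq_dwv hψ1 hy' hy.1]
    have hlow : ∀ y ∈ Ioo u₀ u, 1 ≤ c * ((u - y) / 2) * r (u, y) := by
      intro y hy
      have := hrc _ (hmem y ⟨hy.1.le, hy.2⟩)
      have hx : 0 < (u - y) / 2 := by linarith [hy.2]
      simp only [rho] at this
      rw [← mul_inv, inv_le_iff_one_le_mul₀ (by positivity)] at this
      linarith
    have hbasic : ∀ y ∈ Ioo u₀ u, ∀ F G : ℝ, (F ^ 2 + G ^ 2 * oneMinusMu l r ϖ (u, y))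
        * r (u, y) ^ 2 ≤ e y → G ^ 2 ≤ A * ((u - y) / 2) ^ 4 * e y ∧
          F ^ 2 ≤ A * ((u - y) / 2) ^ 2 * e y := by
      intro y hy F G h
      have hy' : y ∈ Ico u₀ u := ⟨hy.1.le, hy.2⟩
      have h1 := hlow y hy
      have h2 := hw0 _ (hmem y hy')
      have h3 := he0 y hy'
      have h4 := hwn y hy'
      set x := (u - y) / 2
      have hx : 0 < x := by simp only [x]; linarith [hy.2]
      have hr' := hr0 _ (hmem y hy')
      set ρ := r (u, y)
      set W := oneMinusMu l r ϖ (u, y)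
      have p2 : 1 ≤ (c * x * ρ) ^ 2 := one_le_pow₀ h1
      have p4 : 1 ≤ (c * x * ρ) ^ 4 := one_le_pow₀ h1
      have i1 : F ^ 2 * ρ ^ 2 ≤ e y := by
        have : 0 ≤ G ^ 2 * W * ρ ^ 2 := by positivity
        linarith
      have i2 : G ^ 2 * (ρ ^ 2 / (2 * l ^ 2)) * ρ ^ 2 ≤ e y := by
        have a1 : G ^ 2 * (ρ ^ 2 / (2 * l ^ 2)) * ρ ^ 2 ≤ G ^ 2 * W * ρ ^ 2 := by gcongr
        have : 0 ≤ F ^ 2 * ρ ^ 2 := by positivity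
        linarith
      constructor
      · calc G ^ 2 ≤ G ^ 2 * (c * x * ρ) ^ 4 := le_mul_of_one_le_right (by positivity) p4
          _ = 2 * l ^ 2 * c ^ 4 * x ^ 4 * (G ^ 2 * (ρ ^ 2 / (2 * l ^ 2)) * ρ ^ 2) := by
              field_simp
          _ ≤ 2 * l ^ 2 * c ^ 4 * x ^ 4 * e y := by gcongr
          _ ≤ A * x ^ 4 * e y := by
              gcongr
              simp only [hA]
              have : 0 < c ^ 2 := by positivity
              linarith
      · calc F ^ 2 ≤ F ^ 2 * (c * x * ρ) ^ 2 := le_mul_of_one_le_right (by positivity) p2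
          _ = c ^ 2 * x ^ 2 * (F ^ 2 * ρ ^ 2) := by ring
          _ ≤ c ^ 2 * x ^ 2 * e y := by gcongr
          _ ≤ A * x ^ 2 * e y := by
              gcongr
              simp only [hA]
              have : 0 < 2 * l ^ 2 * c ^ 4 := by positivity
              linarith
    have hψe : ∀ y ∈ Ioo u₀ u, ψ (u, y) ^ 2 ≤ A * ((u - y) / 2) ^ 4 * e y ∧
        dwv S ψ (u, y) ^ 2 ≤ A * ((u - y) / 2) ^ 2 * e y := by
      intro y hy
      refine hbasic y hy _ _ ?_
      have := hwn y ⟨hy.1.le, hy.2⟩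
      have : 0 ≤ (dwv S τ (u, y) ^ 2 + τ (u, y) ^ 2 * oneMinusMu l r ϖ (u, y))
        * r (u, y) ^ 2 := by positivity
      simp only [he]
      linarith
    have hτe : ∀ y ∈ Ioo u₀ u, τ (u, y) ^ 2 ≤ A * ((u - y) / 2) ^ 4 * e y ∧
        dwv S τ (u, y) ^ 2 ≤ A * ((u - y) / 2) ^ 2 * e y := by
      intro y hy
      refine hbasic y hy _ _ ?_
      have := hwn y ⟨hy.1.le, hy.2⟩
      have : 0 ≤ (dwv S ψ (u, y) ^ 2 + ψ (u, y) ^ 2 * oneMinusMu l r ϖ (u, y))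
        * r (u, y) ^ 2 := by positivity
      simp only [he]
      linarith
    have hA0 : 0 ≤ A := by positivity
    constructor
    · exact abs_le_of_integral_le (f := fun y => ψ (u, y)) (f' := fun y => dwv S ψ (u, y))
        hA0 hN.le hec he0 hint
        (((continuousOn_dwv hδ hψ1).comp hslice hmaps).mono Ioo_subset_Ico_self)
        (fun y hy => hasDerivAt_slice_snd hψ1 (hmem y ⟨hy.1.le, hy.2⟩) hy.1)
        (fun y hy => (hψe y hy).1) (fun y hy => (hψe y hy).2) ⟨hv, hq.2.1⟩
    · exact abs_le_of_integral_le (f := fun y => τ (u, y)) (f' := fun y => dwv S τ (u, y))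
        hA0 hN.le hec he0 hint
        (((continuousOn_dwv hδ hτ1).comp hslice hmaps).mono Ioo_subset_Ico_self)
        (fun y hy => hasDerivAt_slice_snd hτ1 (hmem y ⟨hy.1.le, hy.2⟩) hy.1)
        (fun y hy => (hτe y hy).1) (fun y hy => (hτe y hy).2) ⟨hv, hq.2.1⟩
  have hg : Continuous fun q => √(3 * A * D) * N * rho q ^ ((3 : ℝ) / 2) := by
    have h1 : Continuous rho := by unfold rho; fun_prop
    exact continuous_const.mul (h1.rpow_const fun _ => Or.inr (by norm_num))
  exact ⟨le_of_forall_interior hψ.continuousOn hg (fun q hq h1 h2 => (main q hq h1 h2).1) hp,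
    le_of_forall_interior hτ1.continuousOn hg (fun q hq h1 h2 => (main q hq h1 h2).2) hp⟩

theorem hasDerivAt_slice_comp {F : ℝ × ℝ → ℝ} {F' u x : ℝ}
    (h : HasDerivAt (fun y => F (u, y)) F' (u - 2 * x)) :
    HasDerivAt (fun x => F (u, u - 2 * x)) (-2 * F') x := by
  have h1 : HasDerivAt (fun x : ℝ => u - 2 * x) (-2) x := by
    refine (((hasDerivAt_id x).const_mul 2).const_sub u).congr_deriv (by ring)
  have h2 : HasDerivAt ((fun y => F (u, y)) ∘ fun x : ℝ => u - 2 * x) (F' * -2) x :=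
    HasDerivAt.comp x h h1
  exact HasDerivAt.congr_deriv (f' := F' * -2) h2 (by ring)

/-- **Proposition 6.2 (pointwise decay for the Klein–Gordon field on a uniformly
asymptotically AdS background).** Under the Breitenlohner–Freedman bound, the stated
background bounds, the wave equation, the `H¹`/`H²`-type energy bounds with constant
`D N²`, and the initial pointwise bound, there are `δ₀, C` depending only on
`a, l, M, b, c, D` such that for `δ ≤ δ₀`:
`|ψ| ≤ C N r^{-3/2-s/2}` and `|ψ_u| + |ψ_v| ≤ C N r^{-1/2-s/2}` on `Δ_{δ,u₀}`. -/
theorem stmt_8 (a l M b c D : ℝ) (ha : -(9 / 8) < a) (hl : 0 < l) (hM : 0 < M)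
    (hb : 0 < b) (hc : 0 < c) (hD : 0 < D) :
    ∃ δ₀ > 0, ∃ C > 0, ∀ u₀ δ : ℝ, 0 < δ → δ ≤ δ₀ →
      ∀ tr ϖ r ψ : ℝ × ℝ → ℝ, ∀ N : ℝ, 0 < N →
      ContDiffOn ℝ 2 tr (Tri u₀ δ) → ContDiffOn ℝ 1 ϖ (Tri u₀ δ) →
      (∀ p ∈ Tri u₀ δ, 1 / 2 ≤ tr p / rho p ∧ tr p / rho p ≤ 2) →
      (∀ p ∈ Tri u₀ δ, |pdu tr p - 1 / 2| ≤ 1 / 4) →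
      (∀ p ∈ Tri u₀ δ, |pdv tr p + 1 / 2| ≤ 1 / 4) →
      (∀ p ∈ Tri u₀ δ, |pdv (fun q => pdu tr q) p| ≤ b * (rho p) ^ 2) →
      (∀ p ∈ Tri u₀ δ, |ϖ p - M| ≤ b * (rho p) ^ (sconst a / 4)) →
      -- the reconstructed area radius
      (∀ p ∈ Tri u₀ δ, 0 < r p) →
      (∀ p ∈ Tri u₀ δ, pdu r p = -(pdu tr p) * oneMinusMuM M l r p) →
      (∀ p ∈ Tri u₀ δ, pdv r p = -(pdv tr p) * oneMinusMuM M l r p) →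
      (∀ u ∈ Set.Ioc u₀ (u₀ + δ),
        Tendsto (fun v => r (u, v)) (nhdsWithin u (Set.Iio u)) atTop) →
      (∀ p ∈ Tri u₀ δ, c⁻¹ * (rho p)⁻¹ ≤ r p ∧ r p ≤ c * (rho p)⁻¹) →
      (∀ p ∈ Tri u₀ δ, 1 / (2 * l ^ 2) ≤ oneMinusMu l r ϖ p / (r p) ^ 2) →
      (∀ p ∈ Tri u₀ δ, 1 / (2 * l ^ 2) ≤ oneMinusMuM M l r p / (r p) ^ 2) →
      (∀ p ∈ Tri u₀ δ, |pdv r p / oneMinusMu l r ϖ p - 1 / 2| ≤ b * (rho p) ^ 3) →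
      (∀ p ∈ Tri u₀ δ, |(-(pdu r p)) / oneMinusMu l r ϖ p - 1 / 2| ≤ b * (rho p) ^ 3) →
      -- the wave equation for ψ
      ContDiffOn ℝ 2 ψ (Tri u₀ δ) →
      (∀ p ∈ Tri u₀ δ,
        pdv (fun q => pdu ψ q) p + (pdu r p / r p) * pdv ψ p + (pdv r p / r p) * pdu ψ p
          + (OmAuxSq M l tr r ϖ p * a / (2 * l ^ 2)) * ψ p = 0) →
      -- energy bounds
      (∀ p ∈ Tri u₀ δ,
        (∫ x in Set.Ioc p.2 p.1,
          ((pdu (fun q => Td ψ q) (x, p.2)) ^ 2 + (pdu ψ (x, p.2)) ^ 2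
            + (ψ (x, p.2)) ^ 2 * oneMinusMu l r ϖ (x, p.2)
            + (Td ψ (x, p.2)) ^ 2 * oneMinusMu l r ϖ (x, p.2)) * (r (x, p.2)) ^ 2)
          ≤ D * N ^ 2) →
      (∀ p ∈ Tri u₀ δ,
        (∫ y in Set.Ioc u₀ p.2,
          ((pdv (fun q => Td ψ q) (p.1, y)) ^ 2 + (pdv ψ (p.1, y)) ^ 2
            + (ψ (p.1, y)) ^ 2 * oneMinusMu l r ϖ (p.1, y)
            + (Td ψ (p.1, y)) ^ 2 * oneMinusMu l r ϖ (p.1, y)) * (r (p.1, y)) ^ 2)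
          ≤ D * N ^ 2) →
      -- pointwise bound on the initial data ray
      (∀ u ∈ Set.Ioc u₀ (u₀ + δ),
        |(r (u, u₀)) ^ ((5 : ℝ) / 2 + sconst a) * pdu ψ (u, u₀) / pdu r (u, u₀)| ≤ N) →
      -- conclusions
      ∀ p ∈ Tri u₀ δ,
        |ψ p| ≤ C * N * (r p) ^ (-(3 : ℝ) / 2 - sconst a / 2) ∧
        |pdu ψ p| + |pdv ψ p| ≤ C * N * (r p) ^ (-(1 : ℝ) / 2 - sconst a / 2) := by
  set s := sconst a with hs
  have hs0 : 0 < s := lt_min (Real.sqrt_pos.2 (by linarith)) one_pos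
  obtain ⟨m, hm⟩ : ∃ m, m = 1 + 2 * (M + b) * c := ⟨_, rfl⟩
  have hm0 : 0 < m := by rw [hm]; positivity
  obtain ⟨K₀, hK₀⟩ : ∃ K, K = √(3 * (c ^ 2 + 2 * l ^ 2 * c ^ 4) * D) := ⟨_, rfl⟩
  have hK₀0 : 0 < K₀ := by rw [hK₀]; positivity
  obtain ⟨KU, hKU⟩ : ∃ K, K = (1 / 2 + b) * (1 / l ^ 2 + m * c ^ 2) * c ^ (1 / 2 + s) := ⟨_, rfl⟩
  have hKU0 : 0 < KU := by rw [hKU]; positivity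
  obtain ⟨E, hE0, hE⟩ := exists_coefficient_bounds a l b c m hl hb hc hm0
  obtain ⟨δ₁, hδ₁, K, hK0, hK⟩ :=
    exists_decay_of_singular_system a E K₀ (2 * KU) ha hE0 hK₀0 (by positivity)
  rw [← hs] at hK
  refine ⟨min δ₁ 1, by positivity,
    K * c ^ (3 / 2 + s / 2) + (2 * K + K₀) * c ^ (1 / 2 + s / 2), by positivity, ?_⟩
  intro u₀ δ hδ hδle tr ϖ r ψ N hN _ hϖ _ htu htv _ hϖb hr0 hru hrv _ hrc hw hwM hk hg hψ hwave
    _ hen hdata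
  set S := Tri u₀ δ with hS
  have hδ1 : δ ≤ 1 := hδle.trans (min_le_right _ _)
  have hδδ : δ ≤ δ₁ := hδle.trans (min_le_left _ _)
  have hψ1 : ContDiffOn ℝ 1 ψ S := hψ.of_le (by norm_num)
  set W := oneMinusMu l r ϖ with hW
  have hρ0 : ∀ p ∈ S, 0 < rho p := fun p hp => by simp only [rho]; linarith [hp.2.1]
  have hρ1 : ∀ p ∈ S, rho p ≤ 1 := fun p hp => by
    simp only [rho]; linarith [hp.1, hp.2.2]
  have hW0 : ∀ p ∈ S, 0 < W p := by
    intro p hp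
    have h0 := hr0 p hp
    have := hw p hp
    rw [le_div_iff₀ (by positivity)] at this
    exact lt_of_lt_of_le (by positivity) this
  have hWM0 : ∀ p ∈ S, 0 < oneMinusMuM M l r p := by
    intro p hp
    have h0 := hr0 p hp
    have := hwM p hp
    rw [le_div_iff₀ (by positivity)] at this
    exact lt_of_lt_of_le (by positivity) this
  have hrd : ∀ p ∈ S, DifferentiableAt ℝ (fun y => r (p.1, y)) p.2 := by
    intro p hp
    by_contra h
    have h1 : pdv r p = 0 := deriv_zero_of_not_differentiableAt h
    have h2 := hrv p hp
    have h3 := (abs_le.1 (htv p hp)).2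
    rw [h1] at h2
    have : 0 < -(pdv tr p) * oneMinusMuM M l r p := mul_pos (by linarith) (hWM0 p hp)
    linarith
  have hrinv : ∀ p ∈ S, (r p)⁻¹ ≤ c * rho p := by
    intro p hp
    have := hρ0 p hp
    rw [inv_le_comm₀ (hr0 p hp) (by positivity), mul_inv]
    exact (hrc p hp).1
  have hWb : ∀ p ∈ S, |W p - r p ^ 2 / l ^ 2| ≤ m := by
    intro p hp
    have h0 := hr0 p hp
    have hρ := hρ0 p hp
    have e : W p - r p ^ 2 / l ^ 2 = 1 - 2 * ϖ p * (r p)⁻¹ := by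
      simp only [hW, oneMinusMu]; ring
    have h1 : |ϖ p| ≤ M + b := by
      have h2 : rho p ^ (s / 4) ≤ 1 := Real.rpow_le_one hρ.le (hρ1 p hp) (by positivity)
      have h3 : b * rho p ^ (s / 4) ≤ b := mul_le_of_le_one_right hb.le h2
      calc |ϖ p| = |(ϖ p - M) + M| := by ring_nf
        _ ≤ |ϖ p - M| + |M| := abs_add_le _ _
        _ ≤ M + b := by rw [abs_of_pos hM]; linarith [hϖb p hp]
    rw [e, hm]
    refine (abs_sub _ _).trans ?_
    rw [abs_one, abs_mul, abs_mul, abs_two, abs_of_pos (inv_pos.2 h0)]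
    have h4 : (r p)⁻¹ ≤ c :=
      (hrinv p hp).trans (mul_le_of_le_one_right hc.le (hρ1 p hp))
    gcongr
  have hapriori : ∀ p ∈ S, |ψ p| ≤ K₀ * N * rho p ^ ((3 : ℝ) / 2) ∧
      |dwu S ψ p + dwv S ψ p| ≤ K₀ * N * rho p ^ ((3 : ℝ) / 2) := by
    intro p hp
    rw [hK₀]
    exact abs_le_of_energy_bound hl hc hδ hN hϖ hr0 hrd (fun q hq => (hrc q hq).1) hw hψ hen hp
  have hdataU : ∀ u ∈ Ioo u₀ (u₀ + δ),
      |dwu S ψ (u, u₀)| ≤ KU * N * ((u - u₀) / 2) ^ (1 / 2 + s) := by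
    intro u hu
    have hp : (u, u₀) ∈ S := ⟨le_rfl, hu.1, hu.2.le⟩
    have hx : 0 < (u - u₀) / 2 := by linarith [hu.1]
    have h0 := hr0 _ hp
    have hW0' := hW0 _ hp
    have hd := hdata u ⟨hu.1, hu.2.le⟩
    rw [pdu_eq_dwu hψ1 hp hu.2] at hd
    have hrinv' : (r (u, u₀))⁻¹ ≤ c * ((u - u₀) / 2) := hrinv _ hp
    have hx1 : (u - u₀) / 2 ≤ 1 := hρ1 _ hp
    have hru' : |pdu r (u, u₀)| ≤ (1 / 2 + b) * (1 / l ^ 2 + m * c ^ 2) * r (u, u₀) ^ 2 := by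
      have e : pdu r (u, u₀) = -(-(pdu r (u, u₀)) / W (u, u₀) * W (u, u₀)) := by
        field_simp
      have h1 : |-(pdu r (u, u₀)) / W (u, u₀)| ≤ 1 / 2 + b := by
        have h2 := hg _ hp
        have h3 : b * rho (u, u₀) ^ 3 ≤ b :=
          mul_le_of_le_one_right hb.le (pow_le_one₀ hx.le hx1)
        rw [abs_le] at h2 ⊢
        constructor <;> linarith
      have h2 : W (u, u₀) ≤ (1 / l ^ 2 + m * c ^ 2) * r (u, u₀) ^ 2 := by
        have h3 := (abs_le.1 (hWb _ hp)).2
        have h4 : 1 ≤ c * r (u, u₀) := by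
          have : (r (u, u₀))⁻¹ ≤ c := hrinv'.trans (mul_le_of_le_one_right hc.le hx1)
          rwa [inv_le_iff_one_le_mul₀ h0] at this
        have h5 : 1 ≤ (c * r (u, u₀)) ^ 2 := one_le_pow₀ h4
        have h6 : m ≤ m * (c * r (u, u₀)) ^ 2 := le_mul_of_one_le_right hm0.le h5
        calc W (u, u₀) ≤ r (u, u₀) ^ 2 / l ^ 2 + m * (c * r (u, u₀)) ^ 2 := by linarith
          _ = _ := by ring
      rw [e, abs_neg, abs_mul, abs_of_pos hW0', mul_assoc (1 / 2 + b)]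
      gcongr
    have hne : pdu r (u, u₀) ≠ 0 := by
      rw [hru _ hp]
      have := (abs_le.1 (htu _ hp)).1
      exact mul_ne_zero (by linarith) (hWM0 _ hp).ne'
    rw [abs_div, div_le_iff₀ (abs_pos.2 hne), abs_mul,
      abs_of_pos (Real.rpow_pos_of_pos h0 _)] at hd
    have e1 : r (u, u₀) ^ ((5 : ℝ) / 2 + s) * ((r (u, u₀))⁻¹ ^ (1 / 2 + s)) = r (u, u₀) ^ 2 := by
      rw [Real.inv_rpow h0.le, ← Real.rpow_neg h0.le, ← Real.rpow_add h0, ← Real.rpow_natCast]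
      congr 1
      push_cast
      ring
    refine le_of_mul_le_mul_left ?_ (Real.rpow_pos_of_pos h0 ((5 : ℝ) / 2 + s))
    calc _ ≤ N * |pdu r (u, u₀)| := hd
      _ ≤ N * ((1 / 2 + b) * (1 / l ^ 2 + m * c ^ 2) * r (u, u₀) ^ 2) := by gcongr
      _ = r (u, u₀) ^ ((5 : ℝ) / 2 + s) * ((1 / 2 + b) * (1 / l ^ 2 + m * c ^ 2) * N *
            (r (u, u₀))⁻¹ ^ (1 / 2 + s)) := by rw [← e1]; ring
      _ ≤ r (u, u₀) ^ ((5 : ℝ) / 2 + s) * ((1 / 2 + b) * (1 / l ^ 2 + m * c ^ 2) * N *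
            (c * ((u - u₀) / 2)) ^ (1 / 2 + s)) := by gcongr
      _ = _ := by rw [Real.mul_rpow hc.le hx.le, hKU]; ring
  have hdataψ : ∀ u ∈ Ioo u₀ (u₀ + δ),
      |ψ (u, u₀)| ≤ 2 * KU * N * ((u - u₀) / 2) ^ (3 / 2 + s) := by
    intro u hu
    have hmem : ∀ x ∈ Ioo 0 (δ / 2), u₀ + 2 * x ∈ Ioo u₀ (u₀ + δ) := fun x hx =>
      ⟨by linarith [hx.1], by linarith [hx.2]⟩
    have hmemS : ∀ x ∈ Ioo 0 (δ / 2), (u₀ + 2 * x, u₀) ∈ S := fun x hx =>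
      ⟨le_rfl, (hmem x hx).1, (hmem x hx).2.le⟩
    have h := abs_le_of_abs_deriv_le_rpow (g := fun x => ψ (u₀ + 2 * x, u₀))
      (g' := fun x => dwu S ψ (u₀ + 2 * x, u₀) * 2) (R := δ / 2) (q := 3 / 2 + s)
      (A := 2 * KU * N) (by positivity)
      (by
        intro x hx
        have h1 := hasDerivAt_slice_fst hψ1 (hmemS x hx) (hmem x hx).2
        have h2 : HasDerivAt (fun x : ℝ => u₀ + 2 * x) 2 x :=
          (((hasDerivAt_id x).const_mul 2).const_add u₀).congr_deriv (by ring)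
        exact HasDerivAt.comp x h1 h2)
      (by
        intro x hx
        have h1 := hdataU _ (hmem x hx)
        have e1 : (u₀ + 2 * x - u₀) / 2 = x := by ring
        have e2 : 3 / 2 + s - 1 = 1 / 2 + s := by ring
        rw [e1] at h1
        rw [e2, abs_mul, abs_two]
        linarith)
      (by
        have hb : Tendsto (fun y : ℝ => K₀ * N * y ^ ((3 : ℝ) / 2)) (𝓝[>] 0) (𝓝 0) := by
          have h : Continuous (fun y : ℝ => K₀ * N * y ^ ((3 : ℝ) / 2)) :=
            continuous_const.mul (Real.continuous_rpow_const (by positivity))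
          have := (h.tendsto 0).mono_left (nhdsWithin_le_nhds (s := Ioi (0:ℝ)))
          simpa [Real.zero_rpow (by norm_num : (3 : ℝ) / 2 ≠ 0)] using this
        refine squeeze_zero_norm' ?_ hb
        filter_upwards [Ioo_mem_nhdsGT (by positivity : 0 < δ / 2)] with x hx
        have h1 := (hapriori _ (hmemS x hx)).1
        have e1 : rho (u₀ + 2 * x, u₀) = x := by simp only [rho]; ring
        rwa [e1] at h1)
      (x := (u - u₀) / 2) ⟨by linarith [hu.1], by linarith [hu.2]⟩
    have e1 : u₀ + 2 * ((u - u₀) / 2) = u := by ring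
    simp only [e1] at h
    have hx : 0 ≤ (u - u₀) / 2 := by linarith [hu.1]
    have h2 : 2 * KU * N / (3 / 2 + s) ≤ 2 * KU * N :=
      div_le_self (by positivity) (by linarith)
    exact h.trans (by gcongr)
  have hinterior : ∀ p ∈ S, p.1 < u₀ + δ → u₀ < p.2 →
      |ψ p| ≤ K * N * rho p ^ (3 / 2 + s / 2) ∧
      |dwu S ψ p| ≤ K * N * rho p ^ (1 / 2 + s / 2) := by
    rintro ⟨u, v⟩ hp hu hv
    have hvu : v < u := hp.2.1
    obtain ⟨R, hR⟩ : ∃ R, R = (u - u₀) / 2 := ⟨_, rfl⟩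
    have hR0 : 0 < R := by rw [hR]; linarith
    have hRδ : R ≤ δ / 2 := by rw [hR]; linarith
    have hmem : ∀ x ∈ Ioc 0 R, (u, u - 2 * x) ∈ S := by
      intro x hx
      have h1 := hx.1
      have h2 := hx.2
      rw [hR] at h2
      exact ⟨by dsimp only; linarith, by dsimp only; linarith, hp.2.2⟩
    have hmem' : ∀ x ∈ Ioo 0 R, (u, u - 2 * x) ∈ S := fun x hx => hmem x ⟨hx.1, hx.2.le⟩
    have hpos : ∀ x ∈ Ioo 0 R, u₀ < u - 2 * x := by
      intro x hx
      have h2 := hx.2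
      rw [hR] at h2
      linarith
    have hrho : ∀ x, rho (u, u - 2 * x) = x := fun x => by simp only [rho]; ring
    have hline : ContinuousOn (fun x : ℝ => (u, u - 2 * x)) (Ioc 0 R) := by fun_prop
    set k : ℝ × ℝ → ℝ := fun q => pdv r q / W q with hkdef
    set g : ℝ × ℝ → ℝ := fun q => -(pdu r q) / W q with hgdef
    have hkW : ∀ q ∈ S, pdv r q = k q * W q := fun q hq => by
      simp only [hkdef]; rw [div_mul_cancel₀ _ (hW0 q hq).ne']
    have hgW : ∀ q ∈ S, pdu r q = -(g q * W q) := fun q hq => by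
      simp only [hgdef]; rw [div_mul_cancel₀ _ (hW0 q hq).ne', neg_neg]
    have hΩ : ∀ q ∈ S, OmAuxSq M l tr r ϖ q = 4 * k q * g q * W q := by
      intro q hq
      have h1 := (hW0 q hq).ne'
      simp only [OmAuxSq, hkdef, hgdef]
      rw [← hW, hru q hq, hrv q hq]
      field_simp
    have hcoef := hE R (by linarith) (fun x => r (u, u - 2 * x)) (fun x => k (u, u - 2 * x))
      (fun x => g (u, u - 2 * x)) (fun x => W (u, u - 2 * x))
      (by
        intro x hx
        have h1 : HasDerivAt (fun y => r (u, y)) (pdv r (u, u - 2 * x)) (u - 2 * x) :=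
          (hrd _ (hmem' x hx)).hasDerivAt
        rw [hkW _ (hmem' x hx)] at h1
        exact hasDerivAt_slice_comp h1)
      (fun x hx => hr0 _ (hmem' x hx))
      (fun x hx => by have := hrc _ (hmem' x hx); rwa [hrho] at this)
      (fun x hx => by have := hk _ (hmem' x hx); rwa [hrho] at this)
      (fun x hx => by have := hg _ (hmem' x hx); rwa [hrho] at this)
      (fun x hx => hWb _ (hmem' x hx))
    have hmain := hK R N hR0 (by linarith) hN (fun x => ψ (u, u - 2 * x))
      (fun x => dwu S ψ (u, u - 2 * x))
      (fun x => dwu S ψ (u, u - 2 * x) + dwv S ψ (u, u - 2 * x)) _ _ _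
      (hψ.continuousOn.comp hline hmem)
      ((contDiffOn_dwu hδ hψ).continuousOn.comp hline hmem)
      (by
        intro x hx
        have h1 := hasDerivAt_slice_comp (hasDerivAt_slice_snd hψ1 (hmem' x hx) (hpos x hx))
        exact h1.congr_deriv (by ring))
      (by
        intro x hx
        have hq := hmem' x hx
        have h1 := hasDerivAt_slice_comp
          (hasDerivAt_slice_snd (contDiffOn_dwu hδ hψ) hq (hpos x hx))
        refine h1.congr_deriv ?_
        have h2 := hwave _ hq
        rw [pdv_pdu_eq hδ hψ hq hu (hpos x hx), pdv_eq_dwv hψ1 hq (hpos x hx),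
          pdu_eq_dwu hψ1 hq hu, hΩ _ hq, hkW _ hq, hgW _ hq] at h2
        linear_combination (-2) * h2)
      (fun x hx => (hcoef x hx).1) (fun x hx => (hcoef x hx).2.1)
      (fun x hx => (hcoef x hx).2.2)
      (fun x hx => by have := (hapriori _ (hmem' x hx)).1; rwa [hrho] at this)
      (fun x hx => by have := (hapriori _ (hmem' x hx)).2; rwa [hrho] at this)
      (by
        have h1 := hdataψ u ⟨by linarith, hu⟩
        rw [← hR] at h1
        have e : u - 2 * R = u₀ := by rw [hR]; ring
        simpa only [e] using h1)
      (by
        have h1 := hdataU u ⟨by linarith, hu⟩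
        rw [← hR] at h1
        have e : u - 2 * R = u₀ := by rw [hR]; ring
        simp only [e]
        refine h1.trans ?_
        have : KU ≤ 2 * KU := by linarith
        gcongr)
      ((u - v) / 2) ⟨by linarith, by rw [hR]; linarith⟩
    have e : u - 2 * ((u - v) / 2) = v := by ring
    simp only [e] at hmain
    exact hmain
  have hcont : ∀ e : ℝ, 0 ≤ e → ∀ A : ℝ, Continuous fun q => A * rho q ^ e := by
    intro e he A
    have h1 : Continuous rho := by unfold rho; fun_prop
    exact continuous_const.mul (h1.rpow_const fun _ => Or.inr he)
  intro p hp
  have hr := hr0 p hp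
  have hρ := hρ0 p hp
  have hψp : |ψ p| ≤ K * N * rho p ^ (3 / 2 + s / 2) :=
    le_of_forall_interior hψ.continuousOn (hcont _ (by positivity) _)
      (fun q hq h1 h2 => (hinterior q hq h1 h2).1) hp
  have hUp : |dwu S ψ p| ≤ K * N * rho p ^ (1 / 2 + s / 2) :=
    le_of_forall_interior (contDiffOn_dwu hδ hψ).continuousOn (hcont _ (by positivity) _)
      (fun q hq h1 h2 => (hinterior q hq h1 h2).2) hp
  have hVp : |dwv S ψ p| ≤ (K + K₀) * N * rho p ^ (1 / 2 + s / 2) := by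
    have h1 : rho p ^ ((3 : ℝ) / 2) ≤ rho p ^ (1 / 2 + s / 2) := by
      refine Real.rpow_le_rpow_of_exponent_ge hρ (hρ1 p hp) ?_
      have : s ≤ 1 := min_le_right _ _
      linarith
    calc |dwv S ψ p| = |(dwu S ψ p + dwv S ψ p) - dwu S ψ p| := by ring_nf
      _ ≤ |dwu S ψ p + dwv S ψ p| + |dwu S ψ p| := abs_sub _ _
      _ ≤ K₀ * N * rho p ^ ((3 : ℝ) / 2) + K * N * rho p ^ (1 / 2 + s / 2) :=
          add_le_add (hapriori p hp).2 hUp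
      _ ≤ K₀ * N * rho p ^ (1 / 2 + s / 2) + K * N * rho p ^ (1 / 2 + s / 2) := by gcongr
      _ = _ := by ring
  have hconv : ∀ e : ℝ, 0 ≤ e → rho p ^ e ≤ c ^ e * r p ^ (-e) := by
    intro e he
    have h1 : rho p ≤ c * (r p)⁻¹ := by
      have := (hrc p hp).2
      rw [← div_eq_mul_inv, le_div_iff₀ hρ] at this
      rw [← div_eq_mul_inv, le_div_iff₀ hr]
      linarith
    calc rho p ^ e ≤ (c * (r p)⁻¹) ^ e := by gcongr
      _ = _ := by rw [Real.mul_rpow hc.le (by positivity), Real.inv_rpow hr.le, Real.rpow_neg hr.le]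
  have e1 : -(3 : ℝ) / 2 - s / 2 = -(3 / 2 + s / 2) := by ring
  have e2 : -(1 : ℝ) / 2 - s / 2 = -(1 / 2 + s / 2) := by ring
  rw [e1, e2]
  constructor
  · calc |ψ p| ≤ K * N * (c ^ (3 / 2 + s / 2) * r p ^ (-(3 / 2 + s / 2))) :=
          hψp.trans (by gcongr; exact hconv _ (by positivity))
      _ = K * c ^ (3 / 2 + s / 2) * N * r p ^ (-(3 / 2 + s / 2)) := by ring
      _ ≤ _ := by
          have : 0 ≤ (2 * K + K₀) * c ^ (1 / 2 + s / 2) := by positivity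
          gcongr ?_ * _ * _
          linarith
  · calc |pdu ψ p| + |pdv ψ p| ≤ |dwu S ψ p| + |dwv S ψ p| :=
          add_le_add (abs_pdu_le hψ1 hp) (abs_pdv_le hψ1 hp)
      _ ≤ (2 * K + K₀) * N * rho p ^ (1 / 2 + s / 2) := by linarith
      _ ≤ (2 * K + K₀) * N * (c ^ (1 / 2 + s / 2) * r p ^ (-(1 / 2 + s / 2))) := by
          gcongr
          exact hconv _ (by positivity)
      _ = (2 * K + K₀) * c ^ (1 / 2 + s / 2) * N * r p ^ (-(1 / 2 + s / 2)) := by ring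
      _ ≤ _ := by
          have : 0 ≤ K * c ^ (3 / 2 + s / 2) := by positivity
          gcongr ?_ * _ * _
          linarith
end
end

section
/- Fix a > −9/8, l > 0, M > 0, s = min(√(9+8a),1), and b > 0. Let r̃, Ω̃, φ be functions on Δ_{δ,u₀} with: 1/2 ≤ r̃/ρ ≤ 2, |r̃_u − 1/2| ≤ 1/4, |r̃_v + 1/2| ≤ 1/4, |log Ω̃²| ≤ b, |φ_u| ≤ b ρ^{1/2+s/4} and |φ| ≤ b ρ^{3/2+s/4}, and let r > 0 be determined by r_u = −r̃_u(1 − 2M/r + r²/l²) and r → ∞ at the diagonal (assume c⁻¹ ρ⁻¹ ≤ r ≤ c ρ⁻¹ for some c depending only on M, l). Define ϖ̂(u,v) = M + ∫_v^u [ −8π r² (−r̃_v/Ω̃²) φ_u² + (4πa/l²) r² r̃_u (1 − 2M/r + r²/l²) φ² ](u′,v) du′. Then there exists C_b > 0, depending only on b, M, l, a, such that on Δ_{δ,u₀}: ρ^{−s/4} |ϖ̂ − M| ≤ C_b ρ^{s/4} and ρ |∂_u ϖ̂| ≤ C_b ρ^{s/2}; in particular, for δ sufficiently small depending only on b, M,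 l, a, both quantities are at most b/100. -/
open Real Set Filter MeasureTheory Topology

noncomputable section

/-- The Hawking-mass iterate of the contraction map:
`ϖ̂(u,v) = M + ∫_v^u [-8π r² (-r̃_v/Ω̃²) φ_u² + (4πa/l²) r² r̃_u (1-μ_M) φ²](u',v) du'`. -/
def hatPomega (a M l : ℝ) (tr tΩ φ r : ℝ × ℝ → ℝ) (p : ℝ × ℝ) : ℝ :=
  M + ∫ x in p.2..p.1,
    (-8 * π * (r (x, p.2)) ^ 2 * (-(pdv tr (x, p.2)) / (tΩ (x, p.2)) ^ 2)
        * (pdu φ (x, p.2)) ^ 2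
      + (4 * π * a / l ^ 2) * (r (x, p.2)) ^ 2 * pdu tr (x, p.2)
          * oneMinusMuM M l r (x, p.2) * (φ (x, p.2)) ^ 2)

/-- A multiple of a power `((x-v)/2)^p` with `p > -1` controls an integral from `v`. -/
theorem abs_integral_le_rpow_half_sub {f : ℝ → ℝ} {v u K p : ℝ} (hvu : v ≤ u) (hp : -1 < p)
    (hf : ∀ x ∈ Set.Ioc v u, |f x| ≤ K * ((x - v) / 2) ^ p) :
    |∫ x in v..u, f x| ≤ K * (2 / (p + 1)) * ((u - v) / 2) ^ (p + 1) := by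
  have hint : IntervalIntegrable (fun x => K * (2 ^ p)⁻¹ * (x - v) ^ p) volume v u := by
    have h := (intervalIntegral.intervalIntegrable_rpow' (a := 0) (b := u - v) hp).comp_sub_right v
    simp only [zero_add, sub_add_cancel] at h
    exact h.const_mul _
  have h1 : ‖∫ x in v..u, f x‖ ≤ ∫ x in v..u, K * (2 ^ p)⁻¹ * (x - v) ^ p := by
    refine intervalIntegral.norm_integral_le_of_norm_le hvu (Eventually.of_forall ?_) hint
    intro x hx
    refine (hf x hx).trans (le_of_eq ?_)
    rw [Real.div_rpow (by linarith [hx.1]) (by norm_num)]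
    ring
  rw [Real.norm_eq_abs] at h1
  refine h1.trans (le_of_eq ?_)
  rw [intervalIntegral.integral_const_mul,
    intervalIntegral.integral_comp_sub_right (fun x => x ^ p) v, integral_rpow (Or.inl hp),
    sub_self, Real.zero_rpow (by linarith), Real.div_rpow (by linarith) (by norm_num),
    Real.rpow_add_one (by norm_num : (2 : ℝ) ≠ 0)]
  have : (2 : ℝ) ^ p ≠ 0 := by positivity
  have : p + 1 ≠ 0 := by linarith
  field_simp
  ring

/-- If `f` is dominated on `(v, u]` by an integrable function and is integrable on `(v, x]` for
every `x ∈ (v, u)`, then it is integrable on `(v, u]`. -/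
theorem intervalIntegrable_of_forall_lt {f g : ℝ → ℝ} {v u : ℝ} (hvu : v < u)
    (hg : IntervalIntegrable g volume v u) (hfg : ∀ x ∈ Set.Ioc v u, |f x| ≤ g x)
    (hf : ∀ x ∈ Set.Ioo v u, IntervalIntegrable f volume v x) :
    IntervalIntegrable f volume v u := by
  rw [intervalIntegrable_iff_integrableOn_Ioo_of_le hvu.le] at hg ⊢
  obtain ⟨w, -, hw, hwt⟩ := exists_seq_strictMono_tendsto' hvu
  have hmeas : AEStronglyMeasurable f (volume.restrict (⋃ n, Set.Ioc v (w n))) := by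
    rw [aestronglyMeasurable_iUnion_iff]
    exact fun n => (hf _ (hw n)).1.aestronglyMeasurable
  have hsub : Set.Ioo v u ⊆ ⋃ n, Set.Ioc v (w n) := by
    intro x hx
    obtain ⟨n, hn⟩ := (hwt.eventually (lt_mem_nhds hx.2)).exists
    exact Set.mem_iUnion.2 ⟨n, hx.1, hn.le⟩
  refine Integrable.mono' hg (hmeas.mono_measure (Measure.restrict_mono hsub le_rfl)) ?_
  filter_upwards [ae_restrict_mem measurableSet_Ioo] with x hx
  exact hfg x ⟨hx.1, hx.2.le⟩

/-- A bound on `f` to the left of `u` bounds the derivative at `u` of its primitive, with no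
regularity assumption on `f`. -/
theorem abs_deriv_integral_le {f g : ℝ → ℝ} {v m u B : ℝ} (hvm : v ≤ m) (hmu : m < u)
    (hB : 0 ≤ B) (hg : IntervalIntegrable g volume v u)
    (hfg : ∀ x ∈ Set.Ioc v u, |f x| ≤ g x) (hf : ∀ x ∈ Set.Ioc m u, |f x| ≤ B) :
    |deriv (fun x => ∫ y in v..x, f y) u| ≤ B := by
  by_cases hd : DifferentiableAt ℝ (fun x => ∫ y in v..x, f y) u
  swap
  · rw [deriv_zero_of_not_differentiableAt hd]; simpa using hB
  have ht := (hasDerivWithinAt_iff_tendsto_slope' Set.self_notMem_Iio).1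
    (hd.hasDerivAt.hasDerivWithinAt (s := Set.Iio u))
  refine le_of_tendsto ht.abs ?_
  have key : ∀ᶠ x in 𝓝[<] u,
      |(∫ y in v..u, f y) - ∫ y in v..x, f y| ≤ B * |u - x| := by
    by_cases hi : IntervalIntegrable f volume v u
    · filter_upwards [Ioo_mem_nhdsLT hmu] with x hx
      have hx' : x ∈ Set.uIcc v u := by
        rw [Set.uIcc_of_le (by linarith)]; exact ⟨by linarith [hx.1], hx.2.le⟩
      have hix : IntervalIntegrable f volume v x :=
        hi.mono_set (Set.uIcc_subset_uIcc_left hx')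
      rw [intervalIntegral.integral_interval_sub_left hi hix, ← Real.norm_eq_abs]
      refine intervalIntegral.norm_integral_le_of_norm_le_const ?_
      intro y hy
      rw [Set.uIoc_of_le hx.2.le] at hy
      exact hf y ⟨hx.1.trans hy.1, hy.2⟩
    · have : ∃ w ∈ Set.Ioo v u, ¬ IntervalIntegrable f volume v w := by
        by_contra! h
        exact hi (intervalIntegrable_of_forall_lt (by linarith) hg hfg h)
      obtain ⟨w, hw, hwi⟩ := this
      filter_upwards [Ioo_mem_nhdsLT hw.2] with x hx
      have hix : ¬ IntervalIntegrable f volume v x := fun h =>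
        hwi (h.mono_set (Set.uIcc_subset_uIcc_left (by
          rw [Set.uIcc_of_le (by linarith [hx.1, hw.1])]; exact ⟨hw.1.le, hx.1.le⟩)))
      rw [intervalIntegral.integral_undef hi, intervalIntegral.integral_undef hix]
      simpa using by positivity
  filter_upwards [key, self_mem_nhdsWithin] with x hx hxu
  have hxu' : (0 : ℝ) < |u - x| := abs_pos.2 (by have : x < u := hxu; linarith)
  rw [slope_comm, slope_def_field, abs_div, div_le_iff₀ hxu']
  exact hx

theorem sconst_pos {a : ℝ} (ha : -(9 / 8) < a) : 0 < sconst a :=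
  lt_min (Real.sqrt_pos.2 (by linarith)) one_pos

theorem sconst_le_one (a : ℝ) : sconst a ≤ 1 := min_le_right _ _

theorem rho_pos {u₀ δ : ℝ} {p : ℝ × ℝ} (hp : p ∈ Tri u₀ δ) : 0 < rho p := by
  have := hp.2.1
  unfold rho
  linarith

/-- The reconstructed radius cannot stay comparable to `ρ⁻¹` for large `ρ`, which bounds `ρ`. -/
theorem rho_le_of_pdu_radius {l M c u₀ δ : ℝ} (hl : 0 < l) (hM : 0 < M) (hc : 0 < c)
    {tr r : ℝ × ℝ → ℝ}
    (htr : ∀ p ∈ Tri u₀ δ, |pdu tr p - 1 / 2| ≤ 1 / 4)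
    (hr0 : ∀ p ∈ Tri u₀ δ, 0 < r p)
    (hru : ∀ p ∈ Tri u₀ δ, pdu r p = -(pdu tr p) * oneMinusMuM M l r p)
    (hr : ∀ p ∈ Tri u₀ δ, c⁻¹ * (rho p)⁻¹ ≤ r p ∧ r p ≤ c * (rho p)⁻¹)
    {p : ℝ × ℝ} (hp : p ∈ Tri u₀ δ) :
    rho p ≤ (1 + c ^ 2) * (2 * c / min M l) := by
  set r₁ := min M l with hr₁
  have hr₁pos : 0 < r₁ := lt_min hM hl
  set ρ₀ := 2 * c / r₁ with hρ₀
  have hρ₀pos : 0 < ρ₀ := by positivity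
  rcases le_or_gt (rho p) ρ₀ with h | h
  · nlinarith [sq_nonneg c]
  obtain ⟨u, v⟩ := p
  obtain ⟨hv, hvu, hu⟩ := hp
  simp only at hv hvu hu
  have hρu : ρ₀ < (u - v) / 2 := h
  have hmem : ∀ x ∈ Set.Icc (v + 2 * ρ₀) u, (x, v) ∈ Tri u₀ δ := fun x hx =>
    ⟨hv, by show v < x; linarith [hx.1], hx.2.trans hu⟩
  have hderiv : ∀ x ∈ Set.Icc (v + 2 * ρ₀) u, 0 < deriv (fun y => r (y, v)) x := by
    intro x hx
    have hx' := hmem x hx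
    have h1 : deriv (fun y => r (y, v)) x = _ := hru _ hx'
    rw [h1]
    have h2 := abs_le.1 (htr _ hx')
    have hpos := hr0 _ hx'
    have hlt : r (x, v) < r₁ := by
      refine (hr _ hx').2.trans_lt ?_
      have hρ : ρ₀ ≤ rho (x, v) := by
        show ρ₀ ≤ (x - v) / 2
        linarith [hx.1]
      rw [← div_eq_mul_inv, div_lt_iff₀ (hρ₀pos.trans_le hρ)]
      have : r₁ * ρ₀ = 2 * c := by rw [hρ₀]; field_simp
      nlinarith
    have hneg : oneMinusMuM M l r (x, v) < 0 := by
      unfold oneMinusMuM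
      have hMr : 2 < 2 * M / r (x, v) := by
        rw [lt_div_iff₀ hpos]; linarith [min_le_left M l]
      have hlr : (r (x, v)) ^ 2 / l ^ 2 ≤ 1 := by
        rw [div_le_one (by positivity)]
        exact pow_le_pow_left₀ hpos.le (by linarith [min_le_right M l]) 2
      linarith
    nlinarith [h2.1]
  have hmono : StrictMonoOn (fun y => r (y, v)) (Set.Icc (v + 2 * ρ₀) u) :=
    strictMonoOn_of_deriv_pos (convex_Icc _ _)
      (fun x hx => (differentiableAt_of_deriv_ne_zero
        (hderiv x hx).ne').continuousAt.continuousWithinAt)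
      (fun x hx => hderiv x (interior_subset hx))
  have hle : v + 2 * ρ₀ < u := by linarith
  have h3 : r (v + 2 * ρ₀, v) < r (u, v) :=
    hmono (Set.left_mem_Icc.2 hle.le) (Set.right_mem_Icc.2 hle.le) hle
  have h4 := (hr _ (hmem _ (Set.left_mem_Icc.2 hle.le))).1
  have h5 := (hr _ (hmem _ (Set.right_mem_Icc.2 hle.le))).2
  have h6 : rho (v + 2 * ρ₀, v) = ρ₀ := by simp [rho]
  rw [h6] at h4
  have h7 : 0 < rho (u, v) := hρ₀pos.trans h
  have h8 : c⁻¹ * ρ₀⁻¹ ≤ c * (rho (u, v))⁻¹ := h4.trans (h3.le.trans h5)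
  have h9 : rho (u, v) ≤ c ^ 2 * ρ₀ := by
    rw [← mul_inv, ← div_eq_mul_inv, inv_eq_one_div, div_le_div_iff₀ (by positivity) h7] at h8
    nlinarith
  linarith

/-- Pointwise bound on the integrand defining `hatPomega`, in terms of bounds on its factors.
Here `q` plays the role of `ρ^{s/2}`. -/
theorem abs_mass_density_le {a l M b c R ρ q r v T U φ ψ : ℝ} (hl : 0 < l) (hM : 0 < M)
    (hc : 0 < c) (hρ : 0 < ρ) (hρR : ρ ≤ R) (hq : 0 ≤ q)
    (hU : |U - 1 / 2| ≤ 1 / 4) (hv : |v + 1 / 2| ≤ 1 / 4) (hT : |Real.log (T ^ 2)| ≤ b)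
    (hψ : ψ ^ 2 ≤ b ^ 2 * (ρ * q)) (hφ : φ ^ 2 ≤ b ^ 2 * (ρ ^ 3 * q))
    (hr1 : c⁻¹ * ρ⁻¹ ≤ r) (hr2 : r ≤ c * ρ⁻¹) :
    |-8 * π * r ^ 2 * (-v / T ^ 2) * ψ ^ 2
      + (4 * π * a / l ^ 2) * r ^ 2 * U * (1 - 2 * M / r + r ^ 2 / l ^ 2) * φ ^ 2| ≤
      (8 * π * c ^ 2 * Real.exp b * b ^ 2 + 4 * π * |a| / l ^ 2 * c ^ 2 * b ^ 2 *
        (R ^ 2 + 2 * M * c * R ^ 3 + c ^ 2 / l ^ 2)) * (q / ρ) := by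
  have hr0 : 0 < r := lt_of_lt_of_le (by positivity) hr1
  have hrsq : r ^ 2 ≤ c ^ 2 * (ρ⁻¹) ^ 2 := by
    rw [← mul_pow]; exact pow_le_pow_left₀ hr0.le hr2 2
  have hrinv : r⁻¹ ≤ c * ρ := by
    have := inv_anti₀ (by positivity) hr1
    simpa [mul_inv, mul_comm] using this
  have hv1 : |v| ≤ 1 := by
    rw [abs_le] at hv ⊢; constructor <;> linarith [hv.1, hv.2]
  have hU1 : |U| ≤ 1 := by
    rw [abs_le] at hU ⊢; constructor <;> linarith [hU.1, hU.2]
  have hTinv : (T ^ 2)⁻¹ ≤ Real.exp b := by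
    rcases (sq_nonneg T).eq_or_lt with h | h
    · rw [← h, inv_zero]; exact (Real.exp_pos b).le
    · rw [← Real.exp_log h, ← Real.exp_neg]
      exact Real.exp_le_exp.2 (by linarith [(abs_le.1 hT).1])
  have hμ : |1 - 2 * M / r + r ^ 2 / l ^ 2| ≤
      (R ^ 2 + 2 * M * c * R ^ 3 + c ^ 2 / l ^ 2) * (ρ⁻¹) ^ 2 := by
    have h1 : |1 - 2 * M / r + r ^ 2 / l ^ 2| ≤ 1 + 2 * M * r⁻¹ + r ^ 2 / l ^ 2 := by
      have : 0 ≤ 2 * M * r⁻¹ := by positivity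
      have : 0 ≤ r ^ 2 / l ^ 2 := by positivity
      rw [div_eq_mul_inv (2 * M) r, abs_le]; constructor <;> linarith
    refine h1.trans ?_
    have h2 : 2 * M * r⁻¹ ≤ 2 * M * (c * ρ) := by gcongr
    have h3 : r ^ 2 / l ^ 2 ≤ c ^ 2 * (ρ⁻¹) ^ 2 / l ^ 2 := by gcongr
    have h4 : (1 : ℝ) ≤ R ^ 2 * (ρ⁻¹) ^ 2 := by
      calc (1 : ℝ) = ρ ^ 2 * (ρ⁻¹) ^ 2 := by field_simp
        _ ≤ _ := by gcongr
    have h5 : 2 * M * (c * ρ) ≤ 2 * M * c * R ^ 3 * (ρ⁻¹) ^ 2 := by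
      calc 2 * M * (c * ρ) = 2 * M * c * ρ ^ 3 * (ρ⁻¹) ^ 2 := by field_simp
        _ ≤ _ := by gcongr
    calc _ ≤ R ^ 2 * (ρ⁻¹) ^ 2 + 2 * M * c * R ^ 3 * (ρ⁻¹) ^ 2
          + c ^ 2 * (ρ⁻¹) ^ 2 / l ^ 2 := by linarith
      _ = _ := by ring
  have hπ := Real.pi_pos
  have hR : 0 < R := hρ.trans_le hρR
  have hA : |-8 * π * r ^ 2 * (-v / T ^ 2) * ψ ^ 2| ≤
      8 * π * c ^ 2 * Real.exp b * b ^ 2 * (q / ρ) := by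
    calc |-8 * π * r ^ 2 * (-v / T ^ 2) * ψ ^ 2|
        = 8 * π * r ^ 2 * (|v| * (T ^ 2)⁻¹) * ψ ^ 2 := by
          simp only [abs_mul, abs_neg, abs_pow, sq_abs, abs_of_pos hπ, div_eq_mul_inv,
            abs_inv]
          norm_num
      _ ≤ 8 * π * (c ^ 2 * (ρ⁻¹) ^ 2) * (1 * Real.exp b) * (b ^ 2 * (ρ * q)) := by gcongr
      _ = _ := by field_simp
  have hB : |(4 * π * a / l ^ 2) * r ^ 2 * U * (1 - 2 * M / r + r ^ 2 / l ^ 2) * φ ^ 2| ≤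
      4 * π * |a| / l ^ 2 * c ^ 2 * b ^ 2 *
        (R ^ 2 + 2 * M * c * R ^ 3 + c ^ 2 / l ^ 2) * (q / ρ) := by
    calc |(4 * π * a / l ^ 2) * r ^ 2 * U * (1 - 2 * M / r + r ^ 2 / l ^ 2) * φ ^ 2|
        = (4 * π * |a| / l ^ 2) * r ^ 2 * |U| * |1 - 2 * M / r + r ^ 2 / l ^ 2| * φ ^ 2 := by
          rw [abs_mul, abs_mul, abs_mul, abs_mul, abs_div, abs_mul, abs_mul, abs_pow, abs_pow,
            abs_pow, sq_abs, sq_abs, sq_abs, abs_of_pos hπ]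
          norm_num
      _ ≤ (4 * π * |a| / l ^ 2) * (c ^ 2 * (ρ⁻¹) ^ 2) * 1 *
          ((R ^ 2 + 2 * M * c * R ^ 3 + c ^ 2 / l ^ 2) * (ρ⁻¹) ^ 2) *
            (b ^ 2 * (ρ ^ 3 * q)) := by gcongr
      _ = _ := by field_simp
  refine (abs_add_le _ _).trans ((add_le_add hA hB).trans (le_of_eq ?_))
  ring

/-- Squaring a weighted bound `|x| ≤ b ρ^{n/2+s/4}`. -/
theorem sq_le_of_abs_le_rpow {x b ρ s : ℝ} (hρ : 0 < ρ) (n : ℕ)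
    (h : |x| ≤ b * ρ ^ ((n : ℝ) / 2 + s / 4)) : x ^ 2 ≤ b ^ 2 * (ρ ^ n * ρ ^ (s / 2)) := by
  have h1 := pow_le_pow_left₀ (abs_nonneg x) h 2
  rw [sq_abs, mul_pow, ← Real.rpow_natCast (ρ ^ ((n : ℝ) / 2 + s / 4)) 2,
    ← Real.rpow_mul hρ.le] at h1
  refine h1.trans (le_of_eq ?_)
  rw [← Real.rpow_natCast ρ n, ← Real.rpow_add hρ]
  congr 2
  push_cast
  ring

/-- **Uniform estimate for the Hawking-mass component of the contraction map
(Section 6.4).** There are `C_b > 0` and `δ₀ > 0`, depending only on `b, M, l, a`, such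
that `ρ^{-s/4} |ϖ̂ - M| ≤ C_b ρ^{s/4}` and `ρ |∂_u ϖ̂| ≤ C_b ρ^{s/2}` on `Δ_{δ,u₀}`; in
particular both quantities are at most `b/100` once `δ ≤ δ₀`. -/
theorem stmt_9 (a l M b c : ℝ) (ha : -(9 / 8) < a) (hl : 0 < l) (hM : 0 < M) (hb : 0 < b)
    (hc : 0 < c) :
    ∃ C > 0, ∃ δ₀ > 0, ∀ u₀ δ : ℝ, 0 < δ →
      ∀ tr tΩ φ r : ℝ × ℝ → ℝ,
      (∀ p ∈ Tri u₀ δ, 1 / 2 ≤ tr p / rho p ∧ tr p / rho p ≤ 2) →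
      (∀ p ∈ Tri u₀ δ, |pdu tr p - 1 / 2| ≤ 1 / 4) →
      (∀ p ∈ Tri u₀ δ, |pdv tr p + 1 / 2| ≤ 1 / 4) →
      (∀ p ∈ Tri u₀ δ, |Real.log ((tΩ p) ^ 2)| ≤ b) →
      (∀ p ∈ Tri u₀ δ, |pdu φ p| ≤ b * (rho p) ^ ((1 : ℝ) / 2 + sconst a / 4)) →
      (∀ p ∈ Tri u₀ δ, |φ p| ≤ b * (rho p) ^ ((3 : ℝ) / 2 + sconst a / 4)) →
      -- the reconstructed area radius
      (∀ p ∈ Tri u₀ δ, 0 < r p) →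
      (∀ p ∈ Tri u₀ δ, pdu r p = -(pdu tr p) * oneMinusMuM M l r p) →
      (∀ u ∈ Set.Ioc u₀ (u₀ + δ),
        Tendsto (fun v => r (u, v)) (nhdsWithin u (Set.Iio u)) atTop) →
      (∀ p ∈ Tri u₀ δ, c⁻¹ * (rho p)⁻¹ ≤ r p ∧ r p ≤ c * (rho p)⁻¹) →
      -- conclusions
      (∀ p ∈ Tri u₀ δ,
        (rho p) ^ (-(sconst a) / 4) * |hatPomega a M l tr tΩ φ r p - M|
            ≤ C * (rho p) ^ (sconst a / 4) ∧
        rho p * |pdu (hatPomega a M l tr tΩ φ r) p| ≤ C * (rho p) ^ (sconst a / 2)) ∧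
      (δ ≤ δ₀ → ∀ p ∈ Tri u₀ δ,
        (rho p) ^ (-(sconst a) / 4) * |hatPomega a M l tr tΩ φ r p - M| ≤ b / 100 ∧
        rho p * |pdu (hatPomega a M l tr tΩ φ r) p| ≤ b / 100) := by
  have hs := sconst_pos ha
  have hs1 := sconst_le_one a
  set s := sconst a with hs_def
  set R := (1 + c ^ 2) * (2 * c / min M l) with hR
  have hRpos : 0 < R := by have := lt_min hM hl; positivity
  have hπ := Real.pi_pos
  set K := 8 * π * c ^ 2 * Real.exp b * b ^ 2 + 4 * π * |a| / l ^ 2 * c ^ 2 * b ^ 2 *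
    (R ^ 2 + 2 * M * c * R ^ 3 + c ^ 2 / l ^ 2) with hK
  have hKpos : 0 < K := by positivity
  set C := K * (4 / s) + 2 * K with hC
  have hCpos : 0 < C := by positivity
  have hε : 0 < b / (100 * C) := by positivity
  refine ⟨C, hCpos, min 1 ((b / (100 * C)) ^ (4 / s)), lt_min one_pos (by positivity), ?_⟩
  intro u₀ δ hδ tr tΩ φ r _ htru htrv hΩ hφu hφ hr0 hru _ hr
  have main : ∀ p ∈ Tri u₀ δ,
      (rho p) ^ (-s / 4) * |hatPomega a M l tr tΩ φ r p - M| ≤ C * (rho p) ^ (s / 4) ∧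
      rho p * |pdu (hatPomega a M l tr tΩ φ r) p| ≤ C * (rho p) ^ (s / 2) := by
    rintro ⟨u, v⟩ hp
    have hρ := rho_pos hp
    obtain ⟨hv, hvu, hu⟩ := hp
    simp only at hv hvu hu
    set F : ℝ → ℝ := fun x => -8 * π * (r (x, v)) ^ 2 * (-(pdv tr (x, v)) / (tΩ (x, v)) ^ 2)
        * (pdu φ (x, v)) ^ 2
      + (4 * π * a / l ^ 2) * (r (x, v)) ^ 2 * pdu tr (x, v)
          * oneMinusMuM M l r (x, v) * (φ (x, v)) ^ 2 with hF
    have hFb : ∀ x ∈ Set.Ioc v u, |F x| ≤ K * ((x - v) / 2) ^ (s / 2 - 1) := by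
      intro x hx
      have hx' : (x, v) ∈ Tri u₀ δ := ⟨hv, hx.1, hx.2.trans hu⟩
      have hρx := rho_pos hx'
      have hψ2 := sq_le_of_abs_le_rpow hρx 1 (by simpa using hφu _ hx')
      have hφ2 := sq_le_of_abs_le_rpow hρx 3 (by simpa using hφ _ hx')
      rw [pow_one] at hψ2
      have := abs_mass_density_le (a := a) hl hM hc hρx
        (rho_le_of_pdu_radius hl hM hc htru hr0 hru hr hx') (by positivity)
        (htru _ hx') (htrv _ hx') (hΩ _ hx') hψ2 hφ2 (hr _ hx').1 (hr _ hx').2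
      rw [← Real.rpow_sub_one hρx.ne'] at this
      exact this
    have hp1 : -1 < s / 2 - 1 := by linarith
    constructor
    · have h1 := abs_integral_le_rpow_half_sub hvu.le hp1 hFb
      have h2 : |hatPomega a M l tr tΩ φ r (u, v) - M| ≤ K * (4 / s) * rho (u, v) ^ (s / 2) := by
        have h3 : hatPomega a M l tr tΩ φ r (u, v) - M = ∫ x in v..u, F x := add_sub_cancel_left _ _
        rw [h3]
        refine h1.trans (le_of_eq ?_)
        rw [sub_add_cancel]
        have : 2 / (s / 2) = 4 / s := by field_simp; norm_num
        rw [this]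
        rfl
      calc rho (u, v) ^ (-s / 4) * |hatPomega a M l tr tΩ φ r (u, v) - M|
          ≤ rho (u, v) ^ (-s / 4) * (K * (4 / s) * rho (u, v) ^ (s / 2)) := by gcongr
        _ = K * (4 / s) * (rho (u, v) ^ (-s / 4) * rho (u, v) ^ (s / 2)) := by ring
        _ = K * (4 / s) * rho (u, v) ^ (s / 4) := by
          rw [← Real.rpow_add hρ]; congr 2; ring
        _ ≤ C * rho (u, v) ^ (s / 4) := by
          have : K * (4 / s) ≤ C := by linarith
          gcongr
    · have hg : IntervalIntegrable (fun x => K * ((x - v) / 2) ^ (s / 2 - 1)) volume v u := by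
        have h := ((intervalIntegral.intervalIntegrable_rpow' (a := 0) (b := u - v)
          hp1).comp_sub_right v).const_mul (K * (2 ^ (s / 2 - 1))⁻¹)
        simp only [zero_add, sub_add_cancel] at h
        refine h.congr ?_
        intro x hx
        rw [Set.uIoc_of_le hvu.le] at hx
        simp only
        rw [Real.div_rpow (by linarith [hx.1]) (by norm_num)]
        ring
      have hFm : ∀ x ∈ Set.Ioc ((u + v) / 2) u,
          |F x| ≤ 2 * K * rho (u, v) ^ (s / 2 - 1) := by
        intro x hx
        refine (hFb x ⟨by linarith [hx.1], hx.2⟩).trans ?_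
        have h1 : ((x - v) / 2) ^ (s / 2 - 1) ≤ (rho (u, v) / 2) ^ (s / 2 - 1) := by
          refine Real.rpow_le_rpow_of_nonpos (by positivity) ?_ (by linarith)
          simp only [rho]
          linarith [hx.1]
        have h2 : (rho (u, v) / 2) ^ (s / 2 - 1) ≤ 2 * rho (u, v) ^ (s / 2 - 1) := by
          rw [Real.div_rpow hρ.le (by norm_num), div_eq_mul_inv, ← Real.rpow_neg (by norm_num),
            mul_comm]
          gcongr
          calc (2 : ℝ) ^ (-(s / 2 - 1)) ≤ 2 ^ (1 : ℝ) :=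
                Real.rpow_le_rpow_of_exponent_le (by norm_num) (by linarith)
            _ = 2 := Real.rpow_one 2
        calc K * ((x - v) / 2) ^ (s / 2 - 1) ≤ K * (2 * rho (u, v) ^ (s / 2 - 1)) := by
              gcongr; exact h1.trans h2
          _ = _ := by ring
      have h1 : |pdu (hatPomega a M l tr tΩ φ r) (u, v)| ≤ 2 * K * rho (u, v) ^ (s / 2 - 1) := by
        have h2 : pdu (hatPomega a M l tr tΩ φ r) (u, v) =
            deriv (fun x => ∫ y in v..x, F y) u := by
          show deriv (fun x => M + ∫ y in v..x, F y) u = _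
          rw [deriv_const_add]
        rw [h2]
        exact abs_deriv_integral_le (by linarith) (by linarith) (by positivity) hg hFb hFm
      calc rho (u, v) * |pdu (hatPomega a M l tr tΩ φ r) (u, v)|
          ≤ rho (u, v) * (2 * K * rho (u, v) ^ (s / 2 - 1)) := by gcongr
        _ = 2 * K * rho (u, v) ^ (s / 2) := by
          rw [Real.rpow_sub_one hρ.ne']; field_simp
        _ ≤ C * rho (u, v) ^ (s / 2) := by
          have : 2 * K ≤ C := by have : 0 < K * (4 / s) := by positivity
                                 linarith
          gcongr
  refine ⟨main, fun hδ₀ p hp => ?_⟩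
  have hρ := rho_pos hp
  have hρδ : rho p ≤ δ := by
    have := hp.1
    have := hp.2.2
    simp only [rho]
    linarith
  have hρ1 : rho p ≤ 1 := hρδ.trans (hδ₀.trans (min_le_left _ _))
  have h4 : rho p ^ (s / 4) ≤ b / (100 * C) := by
    calc rho p ^ (s / 4) ≤ ((b / (100 * C)) ^ (4 / s)) ^ (s / 4) :=
          Real.rpow_le_rpow hρ.le (hρδ.trans (hδ₀.trans (min_le_right _ _))) (by positivity)
      _ = b / (100 * C) := by
          rw [← Real.rpow_mul hε.le, show 4 / s * (s / 4) = 1 by field_simp, Real.rpow_one]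
  have h2 : rho p ^ (s / 2) ≤ rho p ^ (s / 4) :=
    Real.rpow_le_rpow_of_exponent_ge hρ hρ1 (by linarith)
  have hCε : C * (b / (100 * C)) = b / 100 := by field_simp
  have h5 : C * rho p ^ (s / 4) ≤ b / 100 := by rw [← hCε]; gcongr
  have h6 : C * rho p ^ (s / 2) ≤ b / 100 := by rw [← hCε]; gcongr; exact h2.trans h4
  exact ⟨(main p hp).1.trans h5, (main p hp).2.trans h6⟩
end
end
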